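/- There is a θ-invariant full-measure set Ω̃ on which Φ(ω) := lim_{n→∞}(φ(n,ω)ᵀφ(n,ω))^{1/(2n)} exists, and, defining for ω ∈ Ω̃ and x ∈ ℝ^d∖{0} the Lyapunov exponent λ(ω,x) := lim_{n→∞}(1/n)log|φ(n,ω)x| and the filtration V_i(ω) := sum of the eigenspaces of Φ(ω) for its i-th smallest through smallest eigenvalue ordering (i.e. V_i(ω) = U_p(ω) ⊕ ⋯ ⊕ U_i(ω) where U_j(ω) is the eigenspace of Φ(ω) for its j-th largest distinct eigenvalue), one has for every ω ∈ Ω̃: λ(θω, A(ω)x) = λ(ω,x) for all x ∈ ℝ^d∖{0}, and consequently A(ω)V_i(ω) = V_i(θω) for i = 1,…,p(ω). -/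

import Mathlib

open Matrix Filter Topology MeasureTheory

noncomputable section

/-- The Euclidean norm of a vector in `ℝ^d`. -/
def eNorm {ι : Type*} [Fintype ι] (x : ι → ℝ) : ℝ := Real.sqrt (∑ i, x i ^ 2)

/-- The operator norm of a matrix, with respect to the Euclidean norm. -/
def opNorm {ι : Type*} [Fintype ι] (M : Matrix ι ι ℝ) : ℝ :=
  ⨆ x : {x : ι → ℝ // eNorm x ≤ 1}, eNorm (M *ᵥ (x : ι → ℝ))


set_option linter.unusedSectionVars false

def garsiaMax {Ω : Type*} (T : Ω → Ω) (f : Ω → ℝ) : ℕ → Ω → ℝ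
  | 0 => fun _ => 0
  | (n+1) => fun ω => max 0 (f ω + garsiaMax T f n (T ω))

lemma garsiaMax_nonneg {Ω : Type*} (T : Ω → Ω) (f : Ω → ℝ) (n : ℕ) (ω : Ω) :
    0 ≤ garsiaMax T f n ω := by
  cases n with
  | zero => exact le_rfl
  | succ n => exact le_max_left _ _

lemma garsiaMax_mono {Ω : Type*} (T : Ω → Ω) (f : Ω → ℝ) (n : ℕ) :
    ∀ ω, garsiaMax T f n ω ≤ garsiaMax T f (n+1) ω := by
  induction n with
  | zero => intro ω; exact le_max_left _ _
  | succ n ih =>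
    intro ω
    show max 0 (f ω + garsiaMax T f n (T ω)) ≤ max 0 (f ω + garsiaMax T f (n+1) (T ω))
    have := ih (T ω)
    gcongr

lemma birkhoff_le_garsiaMax {Ω : Type*} (T : Ω → Ω) (f : Ω → ℝ) (n : ℕ) :
    ∀ ω, birkhoffSum T f n ω ≤ garsiaMax T f n ω := by
  induction n with
  | zero => intro ω; simp [garsiaMax]
  | succ n ih =>
    intro ω
    rw [birkhoffSum_succ']
    exact le_trans (by linarith [ih (T ω)]) (le_max_right _ _)

section
variable {Ω : Type*} [MeasurableSpace Ω] {μ : Measure Ω} [IsProbabilityMeasure μ] {T : Ω → Ω}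

lemma garsiaMax_measurable (hT : Measurable T) {f : Ω → ℝ} (hf : Measurable f) (n : ℕ) :
    Measurable (garsiaMax T f n) := by
  induction n with
  | zero => exact measurable_const
  | succ n ih => exact measurable_const.max (hf.add (ih.comp hT))

lemma garsiaMax_integrable (hT : MeasurePreserving T μ μ) {f : Ω → ℝ}
    (hf : Integrable f μ) (n : ℕ) : Integrable (garsiaMax T f n) μ := by
  induction n with
  | zero => exact integrable_const 0
  | succ n ih =>
    exact (integrable_const (0:ℝ)).sup (hf.add (hT.integrable_comp_of_integrable ih))

lemma mp_integral_comp (hT : MeasurePreserving T μ μ) {f : Ω → ℝ} (hf : Measurable f) :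
    ∫ ω, f (T ω) ∂μ = ∫ ω, f ω ∂μ := by
  conv_rhs => rw [← hT.map_eq]
  rw [integral_map hT.measurable.aemeasurable hf.aestronglyMeasurable]

lemma garsia (hT : MeasurePreserving T μ μ) {f : Ω → ℝ} (hfm : Measurable f)
    (hf : Integrable f μ) (N : ℕ) :
    0 ≤ ∫ ω in {ω | 0 < garsiaMax T f (N+1) ω}, f ω ∂μ := by
  have hm := garsiaMax_measurable hT.measurable hfm (N+1)
  have hi := garsiaMax_integrable hT hf (N+1)
  have hs : MeasurableSet {ω | 0 < garsiaMax T f (N+1) ω} := measurableSet_lt measurable_const hm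
  rw [← integral_indicator hs]
  have h1 : ∫ ω, (garsiaMax T f (N+1) ω - garsiaMax T f (N+1) (T ω)) ∂μ = 0 := by
    have h5 : Integrable (fun ω => garsiaMax T f (N+1) (T ω)) μ :=
      hT.integrable_comp_of_integrable hi
    rw [integral_sub hi h5, mp_integral_comp hT hm, sub_self]
  refine h1.symm.le.trans (integral_mono (hi.sub (hT.integrable_comp_of_integrable hi)) (hf.indicator hs) ?_)
  intro ω
  simp only [Pi.sub_apply, Function.comp_apply]
  by_cases h : 0 < garsiaMax T f (N+1) ω
  · simp only [Set.indicator, Set.mem_ofPred_eq, h, if_true]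
    have h2 : garsiaMax T f (N+1) ω = max 0 (f ω + garsiaMax T f N (T ω)) := rfl
    have h3 := garsiaMax_mono T f N (T ω)
    rcases max_cases 0 (f ω + garsiaMax T f N (T ω)) with h4 | h4
    · rw [h2, h4.1] at h; exact absurd h (lt_irrefl _)
    · rw [h4.1] at h2; linarith
  · simp only [Set.indicator, Set.mem_ofPred_eq, h, if_false]
    have := garsiaMax_nonneg T f (N+1) (T ω)
    linarith

lemma maximal_ineq (hT : MeasurePreserving T μ μ) {f : Ω → ℝ} (hfm : Measurable f)
    (hf : Integrable f μ) (h0 : ∀ ω, 0 ≤ f ω) {δ : ℝ} (hδ : 0 < δ) :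
    μ {ω | ∃ n : ℕ, δ * n < birkhoffSum T f n ω} ≤ ENNReal.ofReal ((∫ ω, f ω ∂μ) / δ) := by
  set f' : Ω → ℝ := fun ω => f ω - δ with hf'
  have hfm' : Measurable f' := hfm.sub_const δ
  have hfi' : Integrable f' μ := hf.sub (integrable_const δ)
  set E : ℕ → Set Ω := fun N => {ω | 0 < garsiaMax T f' (N+1) ω} with hE
  have hEmeas : ∀ N, MeasurableSet (E N) := fun N =>
    measurableSet_lt measurable_const (garsiaMax_measurable hT.measurable hfm' (N+1))
  have hmono : Monotone E := monotone_nat_of_le_succ fun N ω hω =>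
    lt_of_lt_of_le hω (garsiaMax_mono T f' (N+1) ω)
  have hsub : {ω | ∃ n : ℕ, δ * n < birkhoffSum T f n ω} ⊆ ⋃ N, E N := by
    rintro ω ⟨n, hn⟩
    refine Set.mem_iUnion.2 ⟨n, ?_⟩
    have h1 := birkhoff_le_garsiaMax T f' n ω
    have h2 := garsiaMax_mono T f' n ω
    have h3 : birkhoffSum T f' n ω = birkhoffSum T f n ω - δ * n := by
      simp [birkhoffSum, hf', mul_comm]
    simp only [hE, Set.mem_ofPred_eq]
    linarith
  refine (measure_mono hsub).trans ?_
  rw [hmono.measure_iUnion]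
  refine iSup_le fun N => ?_
  have h1 := garsia hT hfm' hfi' N
  have h2 : ∫ ω in E N, f' ω ∂μ = ∫ ω in E N, f ω ∂μ - μ.real (E N) * δ := by
    rw [hf', integral_sub hf.integrableOn (integrable_const δ).integrableOn]
    simp
  have h3 : ∫ ω in E N, f ω ∂μ ≤ ∫ ω, f ω ∂μ :=
    setIntegral_le_integral hf (Eventually.of_forall h0)
  have h4 : μ.real (E N) ≤ (∫ ω, f ω ∂μ) / δ := by
    rw [le_div_iff₀ hδ]
    have : 0 ≤ ∫ ω in E N, f' ω ∂μ := h1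
    linarith
  rw [← ofReal_measureReal]
  exact ENNReal.ofReal_le_ofReal h4

lemma ae_birkhoff_bdd (hT : MeasurePreserving T μ μ) {f : Ω → ℝ} (hfm : Measurable f)
    (hf : Integrable f μ) (h0 : ∀ ω, 0 ≤ f ω) :
    ∀ᵐ ω ∂μ, ∃ C : ℝ, ∀ n : ℕ, birkhoffSum T f n ω ≤ C * n := by
  rw [ae_iff]
  have h1 : ∀ j : ℕ, μ {ω | ¬ ∃ C : ℝ, ∀ n : ℕ, birkhoffSum T f n ω ≤ C * n} ≤
      ENNReal.ofReal ((∫ ω, f ω ∂μ) / ((j:ℝ) + 1)) := by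
    intro j
    refine le_trans (measure_mono ?_) (maximal_ineq hT hfm hf h0 (δ := (j:ℝ)+1) (by positivity))
    intro ω hω
    simp only [Set.mem_ofPred_eq, not_exists, not_forall, not_le] at hω
    exact hω _
  have h2 : Tendsto (fun j : ℕ => ENNReal.ofReal ((∫ ω, f ω ∂μ) / ((j:ℝ) + 1))) atTop (𝓝 0) := by
    rw [← ENNReal.ofReal_zero]
    apply ENNReal.tendsto_ofReal
    have := (tendsto_one_div_add_atTop_nhds_zero_nat (𝕜 := ℝ)).const_mul (∫ ω, f ω ∂μ)
    simpa [div_eq_mul_inv] using this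
  exact le_antisymm (ge_of_tendsto' h2 h1) (zero_le)

lemma ae_freq_small (hT : MeasurePreserving T μ μ) {B : ℕ → Set Ω}
    (hB : ∀ N, MeasurableSet (B N)) (hB0 : Tendsto (fun N => μ (B N)) atTop (𝓝 0)) :
    ∀ᵐ ω ∂μ, ∀ j : ℕ, ∃ N, ∀ n : ℕ,
      birkhoffSum T ((B N).indicator fun _ => (1:ℝ)) n ω ≤ (1 / ((j:ℝ)+1)) * n := by
  rw [ae_all_iff]
  intro j
  rw [ae_iff]
  set δ : ℝ := 1 / ((j:ℝ)+1) with hδ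
  have hδ0 : 0 < δ := by positivity
  have h1 : ∀ N, μ {ω | ¬ ∃ N, ∀ n : ℕ,
      birkhoffSum T ((B N).indicator fun _ => (1:ℝ)) n ω ≤ δ * n} ≤
      ENNReal.ofReal (μ.real (B N) / δ) := by
    intro N
    have h3 : ∫ ω, (B N).indicator (fun _ => (1:ℝ)) ω ∂μ = μ.real (B N) := by
      rw [integral_indicator (hB N)]; simp
    rw [← h3]
    refine le_trans (measure_mono ?_) (maximal_ineq hT (measurable_const.indicator (hB N))
      ((integrable_const (1:ℝ)).indicator (hB N)) ?_ hδ0)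
    · intro ω hω
      simp only [Set.mem_ofPred_eq, not_exists, not_forall, not_le] at hω
      exact hω N
    · intro ω; exact Set.indicator_nonneg (fun _ _ => zero_le_one) ω
  have h2 : Tendsto (fun N => ENNReal.ofReal (μ.real (B N) / δ)) atTop (𝓝 0) := by
    rw [← ENNReal.ofReal_zero]
    apply ENNReal.tendsto_ofReal
    have h4 : Tendsto (fun N => μ.real (B N)) atTop (𝓝 0) := by
      have := (ENNReal.tendsto_toReal ENNReal.zero_ne_top).comp hB0
      simpa [Measure.real, Function.comp_def] using this
    simpa using h4.div_const δ
  exact le_antisymm (ge_of_tendsto' h2 h1) zero_le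

lemma greedy {T : Ω → Ω} {h : ℕ → Ω → ℝ}
    (hsub : ∀ m n ω, h (m+n) ω ≤ h m ω + h n (T^[m] ω)) (hneg : ∀ n ω, h n ω ≤ 0)
    {F ε : ℝ} (hF : F ≤ 0) (hε : 0 ≤ ε) (B : Set Ω) (N : ℕ) (G : Set Ω)
    (hG : ∀ x ∈ G, ∀ k, T^[k] x ∈ G)
    (hB : ∀ x ∈ G, x ∉ B → ∃ l, 1 ≤ l ∧ l ≤ N ∧ h l x ≤ l * (F + ε)) (n : ℕ) :
    ∀ x ∈ G, h n x ≤ F * (n - N - birkhoffSum T (B.indicator fun _ => (1:ℝ)) n x) + ε * n := by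
  have hb0 : ∀ n x, 0 ≤ birkhoffSum T (B.indicator fun _ => (1:ℝ)) n x := fun n x =>
    Finset.sum_nonneg fun k _ => Set.indicator_nonneg (fun _ _ => zero_le_one) _
  induction n using Nat.strong_induction_on with
  | _ n ih =>
    intro x hx
    by_cases hn : n ≤ N
    · have h1 : (n:ℝ) ≤ N := by exact_mod_cast hn
      have h2 := hb0 n x
      have h3 := hneg n x
      have h4 : 0 ≤ F * (n - N - birkhoffSum T (B.indicator fun _ => (1:ℝ)) n x) :=
        mul_nonneg_of_nonpos_of_nonpos hF (by linarith)
      have h5 : 0 ≤ ε * n := by positivity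
      linarith
    push Not at hn
    by_cases hxB : x ∈ B
    · obtain ⟨m, rfl⟩ : ∃ m, n = 1 + m := ⟨n - 1, by omega⟩
      have h1 := hsub 1 m x
      have h2 := ih m (by omega) (T^[1] x) (hG x hx 1)
      have h3 := hneg 1 x
      have h4 := birkhoffSum_add T (B.indicator fun _ => (1:ℝ)) 1 m x
      rw [birkhoffSum_one, Set.indicator_of_mem hxB] at h4
      rw [h4]
      push_cast
      linarith
    · obtain ⟨l, hl1, hlN, hl⟩ := hB x hx hxB
      obtain ⟨m, rfl⟩ : ∃ m, n = l + m := ⟨n - l, by omega⟩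
      have h1 := hsub l m x
      have h2 := ih m (by omega) (T^[l] x) (hG x hx l)
      have h4 := birkhoffSum_add T (B.indicator fun _ => (1:ℝ)) l m x
      have h5 := hb0 l x
      rw [h4]
      push_cast
      have h6 : 0 ≤ F * (- birkhoffSum T (B.indicator fun _ => (1:ℝ)) l x) :=
        mul_nonneg_of_nonpos_of_nonpos hF (by linarith)
      linarith

end


set_option linter.unusedSectionVars false

section
variable {Ω : Type*} [MeasurableSpace Ω] {μ : Measure Ω} [IsProbabilityMeasure μ] {T : Ω → Ω}

lemma ae_eq_comp_of_le (hT : MeasurePreserving T μ μ) {L : Ω → ℝ} (hL : Measurable L)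
    (h : ∀ᵐ ω ∂μ, L ω ≤ L (T ω)) : ∀ᵐ ω ∂μ, L (T ω) = L ω := by
  set a : Ω → ℝ := fun ω => Real.arctan (L ω) with ha
  have ham : Measurable a := Real.continuous_arctan.measurable.comp hL
  have hai : Integrable a μ := by
    refine Integrable.of_bound ham.aestronglyMeasurable (Real.pi) (Eventually.of_forall fun ω => ?_)
    rw [Real.norm_eq_abs, abs_le]
    have h1 := Real.neg_pi_div_two_lt_arctan (L ω)
    have h2 := Real.arctan_lt_pi_div_two (L ω)
    have h3 := Real.pi_pos
    constructor <;> simp only [ha] <;> linarith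
  have hai2 : Integrable (fun ω => a (T ω)) μ := hT.integrable_comp_of_integrable hai
  have h1 : ∫ ω, (a (T ω) - a ω) ∂μ = 0 := by
    rw [integral_sub hai2 hai, mp_integral_comp hT ham, sub_self]
  have h2 := (integral_eq_zero_iff_of_nonneg_ae (μ := μ) (f := fun ω => a (T ω) - a ω) (by
    filter_upwards [h] with ω hω
    exact sub_nonneg.2 (Real.arctan_strictMono.monotone hω)) (hai2.sub hai)).1 h1
  filter_upwards [h2] with ω hω
  exact Real.arctan_injective (sub_eq_zero.1 hω)

lemma ae_orbit (hT : MeasurePreserving T μ μ) {p : Ω → Prop} (h : ∀ᵐ ω ∂μ, p ω) :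
    ∀ᵐ ω ∂μ, ∀ k : ℕ, p (T^[k] ω) := by
  rw [ae_all_iff]
  intro k
  exact (hT.iterate k).quasiMeasurePreserving.ae h

theorem kingman_neg (hT : MeasurePreserving T μ μ) {h : ℕ → Ω → ℝ}
    (hm : ∀ n, Measurable (h n))
    (hsub : ∀ m n ω, h (m+n) ω ≤ h m ω + h n (T^[m] ω)) (hneg : ∀ n ω, h n ω ≤ 0)
    {g : Ω → ℝ} (hgm : Measurable g) (hgi : Integrable g μ) (hg0 : ∀ ω, 0 ≤ g ω)
    (hlow : ∀ n ω, - birkhoffSum T g n ω ≤ h n ω) :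
    ∀ᵐ ω ∂μ, ∃ l, Tendsto (fun n : ℕ => h n ω / n) atTop (𝓝 l) := by
  set L : Ω → ℝ := fun ω => liminf (fun n : ℕ => h n ω / n) atTop with hLdef
  have hLm : Measurable L := Measurable.liminf fun n => (hm n).div_const _
  have hbd : ∀ᵐ ω ∂μ, ∃ C : ℝ, ∀ n : ℕ, - (C * n) ≤ h n ω := by
    filter_upwards [ae_birkhoff_bdd hT hgm hgi hg0] with ω ⟨C, hC⟩
    exact ⟨C, fun n => by linarith [hC n, hlow n ω]⟩
  have hab : ∀ ω, IsBoundedUnder (· ≤ ·) atTop (fun n : ℕ => h n ω / n) := fun ω =>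
    isBoundedUnder_of ⟨0, fun n => div_nonpos_of_nonpos_of_nonneg (hneg n ω) (by positivity)⟩
  have hbb : ∀ ω, (∃ C : ℝ, ∀ n : ℕ, - (C * n) ≤ h n ω) →
      IsBoundedUnder (· ≥ ·) atTop (fun n : ℕ => h n ω / n) := by
    rintro ω ⟨C, hC⟩
    refine isBoundedUnder_of_eventually_ge (a := -C) ?_
    filter_upwards [eventually_ge_atTop 1] with n hn
    have : (0:ℝ) < n := by exact_mod_cast hn
    rw [le_div_iff₀ this]
    linarith [hC n]
  have hL0 : ∀ ω, (∃ C : ℝ, ∀ n : ℕ, - (C * n) ≤ h n ω) → L ω ≤ 0 := by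
    intro ω hω
    refine liminf_le_of_frequently_le (Frequently.of_forall fun n =>
      div_nonpos_of_nonpos_of_nonneg (hneg n ω) (by positivity)) (hbb ω hω)
  have hinv : ∀ᵐ ω ∂μ, L (T ω) = L ω := by
    apply ae_eq_comp_of_le hT hLm
    filter_upwards [hbd] with ω hω
    refine le_of_forall_lt fun c hc => ?_
    obtain ⟨c', hc1, hc2⟩ := exists_between hc
    obtain ⟨c'', hc3, hc4⟩ := exists_between hc1
    refine lt_of_lt_of_le hc3 ?_
    refine le_liminf_of_le (hab (T ω)).isCoboundedUnder_ge ?_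
    have h1 := eventually_lt_of_lt_liminf hc2 (hbb ω hω)
    have h2 := (tendsto_add_atTop_nat 1).eventually h1
    obtain ⟨K, hK⟩ := exists_nat_gt ((-c') / (c' - c''))
    filter_upwards [h2, eventually_ge_atTop (K+1)] with n hn hn2
    have hnK : (K:ℝ) + 1 ≤ n := by exact_mod_cast hn2
    have hn0 : (0:ℝ) < n := by have : (0:ℝ) ≤ K := by positivity
                               linarith
    rw [lt_div_iff₀ (by positivity)] at hn
    rw [le_div_iff₀ hn0]
    rw [div_lt_iff₀ (by linarith)] at hK
    have h3 := hsub 1 n ω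
    rw [add_comm 1 n] at h3
    have h4 := hneg 1 ω
    have h5 : h n (T^[1] ω) = h n (T ω) := rfl
    push_cast at hn
    nlinarith
  have hinv' : ∀ᵐ ω ∂μ, ∀ k, L (T^[k] ω) = L ω := by
    filter_upwards [ae_orbit hT hinv] with ω hω k
    induction k with
    | zero => rfl
    | succ k ih => rw [Function.iterate_succ_apply', hω k, ih]
  have hB : ∀ j : ℕ, ∀ᵐ ω ∂μ, ∀ i : ℕ, ∃ N, ∀ n : ℕ,
      birkhoffSum T ({x | ∀ l, 1 ≤ l → l ≤ N → l * (L x + 1/((j:ℝ)+1)) < h l x}.indicator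
        fun _ => (1:ℝ)) n ω ≤ (1 / ((i:ℝ)+1)) * n := by
    intro j
    set B : ℕ → Set Ω := fun N => {x | ∀ l, 1 ≤ l → l ≤ N → l * (L x + 1/((j:ℝ)+1)) < h l x}
      with hBdef
    have hBm : ∀ N, MeasurableSet (B N) := by
      intro N
      have : B N = ⋂ l : ℕ, {x | 1 ≤ l → l ≤ N → l * (L x + 1/((j:ℝ)+1)) < h l x} := by
        ext x; simp [hBdef]
      rw [this]
      refine MeasurableSet.iInter fun l => ?_
      by_cases h1 : 1 ≤ l ∧ l ≤ N
      · simp only [h1.1, h1.2, true_imp_iff]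
        exact measurableSet_lt ((hLm.add_const _).const_mul _) (hm l)
      · have : {x | 1 ≤ l → l ≤ N → l * (L x + 1/((j:ℝ)+1)) < h l x} = Set.univ := by
          ext x; simp only [Set.mem_ofPred_eq, Set.mem_univ, iff_true]
          intro a b; exact absurd ⟨a, b⟩ h1
        rw [this]; exact MeasurableSet.univ
    refine ae_freq_small hT hBm ?_
    have hanti : Antitone B := by
      intro N M hNM x hx
      simp only [hBdef, Set.mem_ofPred_eq] at hx ⊢
      exact fun l h1 h2 => hx l h1 (h2.trans hNM)
    have h0 : μ (⋂ N, B N) = 0 := by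
      refine measure_mono_null ?_ (ae_iff.1 hbd)
      intro x hx
      simp only [hBdef, Set.mem_iInter, Set.mem_ofPred_eq] at hx ⊢
      intro hC
      have h1 : L x + 1/((j:ℝ)+1) ≤ L x := by
        refine le_liminf_of_le (hab x).isCoboundedUnder_ge ?_
        filter_upwards [eventually_ge_atTop 1] with n hn
        have : (0:ℝ) < n := by exact_mod_cast hn
        rw [le_div_iff₀ this]
        linarith [hx n n hn le_rfl]
      have h2 : 0 < 1/((j:ℝ)+1) := by positivity
      linarith
    have := tendsto_measure_iInter_atTop (μ := μ) (fun N => (hBm N).nullMeasurableSet) hanti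
      ⟨0, measure_ne_top _ _⟩
    rwa [h0] at this
  have hB' := ae_all_iff.2 hB
  filter_upwards [hbd, ae_orbit hT hbd, hinv', hB'] with ω h1 h1' h2 h3
  refine ⟨L ω, tendsto_order.2 ⟨fun a ha => eventually_lt_of_lt_liminf ha (hbb ω h1), fun a ha => ?_⟩⟩
  have hL := hL0 ω h1
  -- choose parameters
  obtain ⟨j, hj⟩ := exists_nat_one_div_lt (show 0 < (a - L ω) / 3 by linarith)
  obtain ⟨i, hi⟩ := exists_nat_one_div_lt (show 0 < (a - L ω) / (3 * (1 - L ω)) from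
    div_pos (by linarith) (by linarith))
  obtain ⟨N, hN⟩ := h3 j i
  obtain ⟨K, hK⟩ := exists_nat_gt ((-(L ω) * N) / ((a - L ω)/3))
  filter_upwards [eventually_ge_atTop (K+1)] with n hn
  have hnK : (K:ℝ) + 1 ≤ n := by exact_mod_cast hn
  have hn0 : (0:ℝ) < n := by have : (0:ℝ) ≤ K := by positivity
                             linarith
  have hg := greedy hsub hneg hL (ε := 1/((j:ℝ)+1)) (by positivity)
    {x | ∀ l, 1 ≤ l → l ≤ N → l * (L x + 1/((j:ℝ)+1)) < h l x} N {x | ∀ k, L (T^[k] x) = L ω}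
    (by
      intro x hx k
      simp only [Set.mem_ofPred_eq] at hx ⊢
      intro k'
      rw [← Function.iterate_add_apply]; exact hx _)
    (by
      intro x hx hxB
      simp only [Set.mem_ofPred_eq, not_forall, not_lt] at hx hxB
      obtain ⟨l, ha, hb, hc⟩ := hxB
      refine ⟨l, ha, hb, ?_⟩
      have := hx 0
      simp only [Function.iterate_zero, id] at this
      rwa [this] at hc) n ω (by simpa using h2)
  rw [div_lt_iff₀ hn0]
  have hNn := hN n
  rw [div_lt_iff₀ (by linarith)] at hK
  rw [lt_div_iff₀ (by linarith)] at hi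
  set b := birkhoffSum T ({x | ∀ l, 1 ≤ l → l ≤ N → l * (L x + 1/((j:ℝ)+1)) < h l x}.indicator
        fun _ => (1:ℝ)) n ω
  have e1 : -(L ω) * b ≤ -(L ω) * ((1 / ((i:ℝ)+1)) * n) :=
    mul_le_mul_of_nonneg_left hNn (by linarith)
  have e2 : (1 / ((j:ℝ)+1)) * n < (a - L ω)/3 * n := mul_lt_mul_of_pos_right hj hn0
  have hi0 : 0 < 1/((i:ℝ)+1) := by positivity
  have e3 : -(L ω) * (1 / ((i:ℝ)+1)) ≤ (a - L ω)/3 := by nlinarith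
  have e4 : -(L ω) * (1 / ((i:ℝ)+1)) * n ≤ (a - L ω)/3 * n := mul_le_mul_of_nonneg_right e3 hn0.le
  have e5 : (K:ℝ) * ((a - L ω)/3) ≤ n * ((a - L ω)/3) :=
    mul_le_mul_of_nonneg_right (by linarith) (by linarith)
  nlinarith

theorem birkhoff_nonneg (hT : MeasurePreserving T μ μ)
    {g : Ω → ℝ} (hgm : Measurable g) (hgi : Integrable g μ) (hg0 : ∀ ω, 0 ≤ g ω) :
    ∀ᵐ ω ∂μ, ∃ l, Tendsto (fun n : ℕ => birkhoffSum T g n ω / n) atTop (𝓝 l) := by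
  have hmeas : ∀ n, Measurable (fun ω => - birkhoffSum T g n ω) := fun n =>
    (Finset.measurable_fun_sum _ fun k _ => hgm.comp (hT.measurable.iterate k)).neg
  have := kingman_neg hT (h := fun n ω => - birkhoffSum T g n ω) hmeas
    (fun m n ω => by rw [birkhoffSum_add]; linarith)
    (fun n ω => neg_nonpos.2 (Finset.sum_nonneg fun k _ => hg0 _)) hgm hgi hg0 (fun n ω => le_rfl)
  filter_upwards [this] with ω ⟨l, hl⟩
  refine ⟨-l, ?_⟩
  have := hl.neg
  simpa [neg_div] using this

theorem kingman (hT : MeasurePreserving T μ μ) {f : ℕ → Ω → ℝ}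
    (hm : ∀ n, Measurable (f n))
    (hsub : ∀ m n ω, f (m+n) ω ≤ f m ω + f n (T^[m] ω))
    {g : Ω → ℝ} (hgm : Measurable g) (hgi : Integrable g μ) (hg0 : ∀ ω, 0 ≤ g ω)
    (hup : ∀ n ω, f (n+1) ω ≤ birkhoffSum T g (n+1) ω)
    (hlow : ∀ n ω, - birkhoffSum T g (n+1) ω ≤ f (n+1) ω) :
    ∀ᵐ ω ∂μ, ∃ l, Tendsto (fun n : ℕ => f n ω / n) atTop (𝓝 l) := by
  have hbm : ∀ n, Measurable (birkhoffSum T g n) := fun n =>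
    (Finset.measurable_fun_sum _ fun k _ => hgm.comp (hT.measurable.iterate k))
  have h1 := kingman_neg hT (h := fun n ω => if n = 0 then 0 else f n ω - birkhoffSum T g n ω)
    (g := fun ω => 2 * g ω)
    (fun n => by
      by_cases hn : n = 0
      · simp [hn]
      · simp only [hn, if_false]; exact (hm n).sub (hbm n))
    (fun m n ω => by
      rcases Nat.eq_zero_or_pos m with rfl | hm'
      · simp
      rcases Nat.eq_zero_or_pos n with rfl | hn'
      · simp
      rw [if_neg (by omega), if_neg (by omega), if_neg (by omega), birkhoffSum_add]
      linarith [hsub m n ω])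
    (fun n ω => by
      cases n with
      | zero => simp
      | succ n => simp only [Nat.succ_ne_zero, if_false]; linarith [hup n ω])
    (hgm.const_mul 2) (hgi.const_mul 2) (fun ω => by linarith [hg0 ω])
    (fun n ω => by
      cases n with
      | zero => simp
      | succ n =>
        simp only [Nat.succ_ne_zero, if_false]
        have : birkhoffSum T (fun ω => 2 * g ω) (n+1) ω = 2 * birkhoffSum T g (n+1) ω := by
          simp [birkhoffSum, Finset.mul_sum]
        linarith [hlow n ω])
  filter_upwards [h1, birkhoff_nonneg hT hgm hgi hg0] with ω ⟨l, hl⟩ ⟨l', hl'⟩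
  refine ⟨l + l', (hl.add hl').congr' ?_⟩
  filter_upwards [eventually_ge_atTop 1] with n hn
  rw [if_neg (by omega)]
  ring

theorem birkhoff_term (hT : MeasurePreserving T μ μ)
    {g : Ω → ℝ} (hgm : Measurable g) (hgi : Integrable g μ) (hg0 : ∀ ω, 0 ≤ g ω) :
    ∀ᵐ ω ∂μ, Tendsto (fun n : ℕ => g (T^[n] ω) / n) atTop (𝓝 0) := by
  filter_upwards [birkhoff_nonneg hT hgm hgi hg0] with ω ⟨l, hl⟩
  have h1 := hl.comp (tendsto_add_atTop_nat 1)
  have h2 : Tendsto (fun n : ℕ => ((n:ℝ)+1)/n) atTop (𝓝 1) := by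
    have := (tendsto_const_div_atTop_nhds_zero_nat (1:ℝ)).const_add 1
    rw [add_zero] at this
    refine this.congr' ?_
    filter_upwards [eventually_ge_atTop 1] with n hn
    have : (0:ℝ) < n := by exact_mod_cast hn
    field_simp
  have h3 := (h1.mul h2).sub hl
  rw [mul_one, sub_self] at h3
  refine h3.congr' ?_
  filter_upwards [eventually_ge_atTop 1] with n hn
  have : (0:ℝ) < n := by exact_mod_cast hn
  simp only [Function.comp_apply, birkhoffSum_succ]
  push_cast
  field_simp
  ring

end



section compound
variable {d k : ℕ}

lemma det_mul_sum (X : Matrix (Fin k) (Fin d) ℝ) (Y : Matrix (Fin d) (Fin k) ℝ) :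
    det (X * Y) = ∑ c : Fin k → Fin d, (∏ i, X i (c i)) * det (Y.submatrix c id) := by
  have h1 : (X * Y) = fun i => ∑ j, X i j • Y j := by
    ext i j
    simp [Matrix.mul_apply]
  have h2 : det (X * Y) = detRowAlternating (fun i => ∑ j, X i j • Y j) := by
    rw [← h1]; rfl
  rw [h2]
  have h3 := (detRowAlternating (n := Fin k) (R := ℝ)).toMultilinearMap.map_sum
    (fun i j => X i j • Y j)
  refine h3.trans (Finset.sum_congr rfl fun c _ => ?_)
  have h4 := (detRowAlternating (n := Fin k) (R := ℝ)).toMultilinearMap.map_smul_univ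
    (fun i => X i (c i)) (fun i => Y (c i))
  exact h4

lemma cauchyBinet (X : Matrix (Fin k) (Fin d) ℝ) (Y : Matrix (Fin d) (Fin k) ℝ) :
    ∑ c : Fin k → Fin d, det (X.submatrix id c) * det (Y.submatrix c id)
      = (k.factorial : ℝ) * det (X * Y) := by
  have h1 : ∀ c : Fin k → Fin d, det (X.submatrix id c) =
      ∑ σ : Equiv.Perm (Fin k), ((σ.sign : ℤ) : ℝ) * ∏ i, X i (c (σ i)) := by
    intro c
    rw [← det_transpose, det_apply']
    simp
  simp_rw [h1, Finset.sum_mul]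
  rw [Finset.sum_comm]
  have h2 : ∀ σ : Equiv.Perm (Fin k), ∑ c : Fin k → Fin d,
      ((σ.sign : ℤ) : ℝ) * (∏ i, X i (c (σ i))) * det (Y.submatrix c id) = det (X * Y) := by
    intro σ
    rw [det_mul_sum, ← Equiv.sum_comp (Equiv.arrowCongr σ (Equiv.refl (Fin d)))]
    refine Finset.sum_congr rfl fun c _ => ?_
    have h3 : det (Y.submatrix (Equiv.arrowCongr σ (Equiv.refl (Fin d)) c) id) =
        ((σ.sign : ℤ) : ℝ) * det (Y.submatrix c id) := by
      have := det_permute σ⁻¹ (Y.submatrix c id)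
      rw [Equiv.Perm.sign_inv] at this
      rw [← this]
      rfl
    rw [h3]
    have h4 : ((σ.sign : ℤ) : ℝ) * ((σ.sign : ℤ) : ℝ) = 1 := by
      rcases Int.units_eq_one_or σ.sign with h | h <;> simp [h]
    have h5 : ∀ i, Equiv.arrowCongr σ (Equiv.refl (Fin d)) c (σ i) = c i := by
      intro i; simp [Equiv.arrowCongr]
    simp_rw [h5]
    linear_combination (∏ i, X i (c i)) * det (Y.submatrix c id) * h4
  rw [Finset.sum_congr rfl fun σ _ => h2 σ]
  simp [Fintype.card_perm]

def cmp2 (k : ℕ) (M : Matrix (Fin d) (Fin d) ℝ) : ℝ :=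
  ∑ r : Fin k → Fin d, ∑ c : Fin k → Fin d, det (M.submatrix r c) ^ 2

lemma compound_mul (M N : Matrix (Fin d) (Fin d) ℝ) (r s : Fin k → Fin d) :
    ∑ c : Fin k → Fin d, det (M.submatrix r c) * det (N.submatrix c s)
      = (k.factorial : ℝ) * det ((M * N).submatrix r s) := by
  have := cauchyBinet (M.submatrix r id) (N.submatrix id s)
  have h : M.submatrix r id * N.submatrix id s = (M * N).submatrix r s := by
    ext i j; simp [Matrix.mul_apply]
  rw [h] at this
  simpa using this

lemma cmp2_nonneg (M : Matrix (Fin d) (Fin d) ℝ) : 0 ≤ cmp2 k M :=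
  Finset.sum_nonneg fun _ _ => Finset.sum_nonneg fun _ _ => sq_nonneg _

lemma cmp2_mul (M N : Matrix (Fin d) (Fin d) ℝ) :
    (k.factorial : ℝ)^2 * cmp2 k (M * N) ≤ cmp2 k M * cmp2 k N := by
  have hN : cmp2 k N = ∑ s : Fin k → Fin d, ∑ c : Fin k → Fin d, det (N.submatrix c s) ^ 2 :=
    Finset.sum_comm
  rw [hN]
  unfold cmp2
  rw [Finset.sum_mul_sum, Finset.mul_sum]
  refine Finset.sum_le_sum fun r _ => ?_
  rw [Finset.mul_sum]
  refine Finset.sum_le_sum fun s _ => ?_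
  rw [← mul_pow, ← compound_mul]
  exact Finset.sum_mul_sq_le_sq_mul_sq _ _ _

def ctr (k : ℕ) (M : Matrix (Fin d) (Fin d) ℝ) : ℝ :=
  ∑ r : Fin k → Fin d, det (M.submatrix r r)

lemma ctr_comm (M N : Matrix (Fin d) (Fin d) ℝ) : ctr k (M * N) = ctr k (N * M) := by
  have hk : (k.factorial : ℝ) ≠ 0 := by positivity
  apply mul_left_cancel₀ hk
  unfold ctr
  rw [Finset.mul_sum, Finset.mul_sum]
  simp_rw [← compound_mul]
  rw [Finset.sum_comm]
  refine Finset.sum_congr rfl fun _ _ => Finset.sum_congr rfl fun _ _ => mul_comm _ _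

lemma cmp2_eq_ctr (M : Matrix (Fin d) (Fin d) ℝ) :
    cmp2 k M = (k.factorial : ℝ) * ctr k (Mᵀ * M) := by
  unfold ctr
  rw [Finset.mul_sum]
  simp_rw [← compound_mul]
  unfold cmp2
  rw [Finset.sum_comm]
  refine Finset.sum_congr rfl fun r _ => Finset.sum_congr rfl fun c _ => ?_
  rw [sq]
  congr 1
  rw [← det_transpose]; rfl

lemma ctr_diag_term (q : Fin d → ℝ) (r : Fin k → Fin d) :
    det ((diagonal q).submatrix r r) = if Function.Injective r then ∏ i, q (r i) else 0 := by
  split_ifs with h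
  · rw [submatrix_diagonal q r h, det_diagonal]; rfl
  · simp only [Function.Injective, not_forall] at h
    obtain ⟨i, j, hij, hne⟩ := h
    refine det_zero_of_row_eq hne ?_
    ext l
    simp [hij]

lemma prod_inj_le (hk : k ≤ d) {q : Fin d → ℝ} (hq0 : ∀ i, 0 ≤ q i) (hq : Antitone q)
    {r : Fin k → Fin d} (hr : Function.Injective r) :
    ∏ i, q (r i) ≤ ∏ i : Fin k, q (Fin.castLE hk i) := by
  set σ := Tuple.sort r
  have hmono : Monotone (r ∘ σ) := Tuple.monotone_sort r
  have hs : StrictMono (r ∘ σ) := hmono.strictMono_of_injective (hr.comp σ.injective)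
  rw [← Equiv.prod_comp σ]
  refine Finset.prod_le_prod (fun i _ => hq0 _) fun i _ => hq ?_
  have key : ∀ m : ℕ, ∀ hm : m < k, m ≤ ((r ∘ σ) ⟨m, hm⟩ : ℕ) := by
    intro m
    induction m with
    | zero => intro _; exact Nat.zero_le _
    | succ m ih =>
      intro hm
      have h1 := ih (by omega)
      have h2 : (r ∘ σ) ⟨m, by omega⟩ < (r ∘ σ) ⟨m+1, hm⟩ := hs (by simp)
      have h3 : ((r ∘ σ) ⟨m, by omega⟩ : ℕ) < ((r ∘ σ) ⟨m+1, hm⟩ : ℕ) := h2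
      omega
  exact key i i.2

lemma ctr_diag_bounds (hk : k ≤ d) {q : Fin d → ℝ} (hq0 : ∀ i, 0 ≤ q i) (hq : Antitone q) :
    ∏ i : Fin k, q (Fin.castLE hk i) ≤ ctr k (diagonal q) ∧
    ctr k (diagonal q) ≤ (d:ℝ)^k * ∏ i : Fin k, q (Fin.castLE hk i) := by
  unfold ctr
  simp_rw [ctr_diag_term]
  constructor
  · have := Finset.single_le_sum (s := Finset.univ)
      (f := fun r : Fin k → Fin d => if Function.Injective r then ∏ i, q (r i) else 0)
      (fun r _ => by
        split_ifs
        · exact Finset.prod_nonneg fun i _ => hq0 _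
        · exact le_rfl) (Finset.mem_univ (Fin.castLE hk))
    simpa [Fin.castLE_injective] using this
  · have : ∀ r ∈ (Finset.univ : Finset (Fin k → Fin d)),
        (if Function.Injective r then ∏ i, q (r i) else 0) ≤ ∏ i : Fin k, q (Fin.castLE hk i) := by
      intro r _
      split_ifs with h
      · exact prod_inj_le hk hq0 hq h
      · exact Finset.prod_nonneg fun i _ => hq0 _
    refine (Finset.sum_le_sum this).trans ?_
    simp

/-- normalised log compound norm -/
def lcmp (k : ℕ) (M : Matrix (Fin d) (Fin d) ℝ) : ℝ :=
  Real.log (cmp2 k M / (k.factorial : ℝ)^2)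

lemma cmp2_one_pos (hk : k ≤ d) : 0 < cmp2 k (1 : Matrix (Fin d) (Fin d) ℝ) := by
  rw [cmp2_eq_ctr]
  have h := (ctr_diag_bounds hk (q := fun _ => (1:ℝ)) (fun _ => zero_le_one)
    (fun _ _ _ => le_rfl)).1
  simp only [Finset.prod_const_one, diagonal_one] at h
  rw [transpose_one, one_mul]
  have : (0:ℝ) < k.factorial := by positivity
  nlinarith

lemma cmp2_pos (hk : k ≤ d) (M : GL (Fin d) ℝ) :
    0 < cmp2 k (M : Matrix (Fin d) (Fin d) ℝ) := by
  have h := cmp2_mul (k := k) (M : Matrix (Fin d) (Fin d) ℝ) ((M⁻¹ : GL (Fin d) ℝ) : Matrix (Fin d) (Fin d) ℝ)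
  rw [← Units.val_mul, mul_inv_cancel, Units.val_one] at h
  have h1 := cmp2_one_pos hk
  have h2 : (0:ℝ) < (k.factorial : ℝ)^2 := by positivity
  rcases (cmp2_nonneg (k := k) (M : Matrix (Fin d) (Fin d) ℝ)).lt_or_eq with h3 | h3
  · exact h3
  · rw [← h3] at h; nlinarith

lemma lcmp_mul (hk : k ≤ d) (M N : GL (Fin d) ℝ) :
    lcmp k ((M * N : GL (Fin d) ℝ) : Matrix (Fin d) (Fin d) ℝ) ≤
      lcmp k (M : Matrix (Fin d) (Fin d) ℝ) + lcmp k (N : Matrix (Fin d) (Fin d) ℝ) := by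
  have h2 : (0:ℝ) < (k.factorial : ℝ)^2 := by positivity
  have hM := cmp2_pos hk M
  have hN := cmp2_pos hk N
  have hMN := cmp2_pos hk (M * N)
  unfold lcmp
  rw [← Real.log_mul (by positivity) (by positivity)]
  apply Real.log_le_log (by positivity)
  rw [div_mul_div_comm, div_le_div_iff₀ h2 (by positivity)]
  have := cmp2_mul (k := k) (M : Matrix (Fin d) (Fin d) ℝ) (N : Matrix (Fin d) (Fin d) ℝ)
  rw [Units.val_mul]
  nlinarith

lemma lcmp_inv (hk : k ≤ d) (M : GL (Fin d) ℝ) :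
    - lcmp k ((M⁻¹ : GL (Fin d) ℝ) : Matrix (Fin d) (Fin d) ℝ) ≤
      lcmp k (M : Matrix (Fin d) (Fin d) ℝ) := by
  have h1 := lcmp_mul hk M M⁻¹
  have h2 := lcmp_mul hk (1 : GL (Fin d) ℝ) 1
  rw [mul_inv_cancel] at h1
  rw [mul_one] at h2
  linarith

lemma lcmp_le_of_entries (hk : k ≤ d) (M : GL (Fin d) ℝ) {b : ℝ}
    (hb : ∀ i j, |(M : Matrix (Fin d) (Fin d) ℝ) i j| ≤ b) (hb1 : 1 ≤ b) :
    lcmp k (M : Matrix (Fin d) (Fin d) ℝ) ≤ Real.log ((d:ℝ)^k * (d:ℝ)^k) + 2 * k * Real.log b := by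
  rcases Nat.eq_zero_or_pos d with rfl | hd
  · have : k = 0 := by omega
    subst this
    simp [lcmp, cmp2]
  have hd' : (0:ℝ) < d := by exact_mod_cast hd
  have h2 : (0:ℝ) < (k.factorial : ℝ)^2 := by positivity
  have hM := cmp2_pos hk M
  have h1 : cmp2 k (M : Matrix (Fin d) (Fin d) ℝ) ≤
      (d:ℝ)^k * ((d:ℝ)^k * ((k.factorial : ℝ) * b^k)^2) := by
    unfold cmp2
    have : ∀ r c : Fin k → Fin d, det ((M : Matrix (Fin d) (Fin d) ℝ).submatrix r c)^2 ≤
        ((k.factorial : ℝ) * b^k)^2 := by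
      intro r c
      have := Matrix.det_le (A := (M : Matrix (Fin d) (Fin d) ℝ).submatrix r c)
        (abv := AbsoluteValue.abs) (x := b) (fun i j => hb _ _)
      rw [sq_le_sq, abs_of_nonneg (a := (k.factorial : ℝ) * b^k) (by positivity)]
      simpa using this
    refine (Finset.sum_le_sum fun r _ => Finset.sum_le_sum fun c _ => this r c).trans ?_
    simp
  unfold lcmp
  have e : Real.log ((d:ℝ)^k * (d:ℝ)^k) + 2 * k * Real.log b =
      Real.log ((d:ℝ)^k * (d:ℝ)^k * b^(2*k)) := by
    rw [Real.log_mul (x := (d:ℝ)^k * (d:ℝ)^k) (by positivity) (by positivity), Real.log_pow b]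
    push_cast; ring
  rw [e]
  apply Real.log_le_log (by positivity)
  rw [div_le_iff₀ h2]
  refine h1.trans (le_of_eq ?_)
  ring

lemma lcmp_svd (hk : k ≤ d) (M : GL (Fin d) ℝ) {U : Matrix (Fin d) (Fin d) ℝ} {q : Fin d → ℝ}
    (hU : Uᵀ * U = 1) (hq0 : ∀ i, 0 < q i) (hq : Antitone q)
    (hM : (M : Matrix (Fin d) (Fin d) ℝ)ᵀ * (M : Matrix (Fin d) (Fin d) ℝ) = U * diagonal q * Uᵀ) :
    |lcmp k (M : Matrix (Fin d) (Fin d) ℝ) - ∑ i : Fin k, Real.log (q (Fin.castLE hk i))| ≤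
      Real.log k.factorial + k * Real.log d := by
  have hc : cmp2 k (M : Matrix (Fin d) (Fin d) ℝ) = (k.factorial : ℝ) * ctr k (diagonal q) := by
    rw [cmp2_eq_ctr, hM, ctr_comm, ← mul_assoc, hU, one_mul]
  obtain ⟨h1, h2⟩ := ctr_diag_bounds hk (fun i => (hq0 i).le) hq
  have hf : (0:ℝ) < k.factorial := by positivity
  have hf1 : (1:ℝ) ≤ k.factorial := by exact_mod_cast Nat.one_le_iff_ne_zero.2 (Nat.factorial_ne_zero k)
  have hp : 0 < ∏ i : Fin k, q (Fin.castLE hk i) := Finset.prod_pos fun i _ => hq0 _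
  have hlog : Real.log (∏ i : Fin k, q (Fin.castLE hk i)) =
      ∑ i : Fin k, Real.log (q (Fin.castLE hk i)) := Real.log_prod fun i _ => (hq0 _).ne'
  have hctr : 0 < ctr k (diagonal q) := lt_of_lt_of_le hp h1
  have hL : lcmp k (M : Matrix (Fin d) (Fin d) ℝ) =
      Real.log (ctr k (diagonal q)) - Real.log k.factorial := by
    unfold lcmp
    rw [hc, ← Real.log_div hctr.ne' hf.ne']
    congr 1
    field_simp
  have hlf : 0 ≤ Real.log k.factorial := Real.log_nonneg hf1
  have hld : 0 ≤ (k:ℝ) * Real.log d := mul_nonneg (by positivity) (Real.log_natCast_nonneg d)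
  have h3 := Real.log_le_log hp h1
  have hdk : (d:ℝ)^k ≠ 0 := by
    intro h0; rw [h0, zero_mul] at h2; linarith
  have h4 := Real.log_le_log hctr h2
  rw [Real.log_mul hdk hp.ne', Real.log_pow] at h4
  rw [hL, ← hlog, abs_le]
  constructor <;> linarith

lemma measurable_cmp {Ω : Type*} [MeasurableSpace Ω] {M : Ω → Matrix (Fin d) (Fin d) ℝ}
    (hM : ∀ i j, Measurable fun ω => M ω i j) : Measurable fun ω => lcmp k (M ω) := by
  unfold lcmp cmp2
  refine Real.measurable_log.comp (Measurable.div_const ?_ _)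
  refine Finset.measurable_fun_sum _ fun r _ => Finset.measurable_fun_sum _ fun c _ => ?_
  refine Measurable.pow_const ?_ 2
  simp_rw [det_apply']
  refine Finset.measurable_fun_sum _ fun σ _ => ?_
  refine Measurable.const_mul ?_ _
  exact Finset.measurable_fun_prod _ fun i _ => hM _ _

lemma measurable_det' {Ω : Type*} [MeasurableSpace Ω] {M : Ω → Matrix (Fin d) (Fin d) ℝ}
    (hM : ∀ i j, Measurable fun ω => M ω i j) : Measurable fun ω => det (M ω) := by
  simp_rw [det_apply']
  refine Finset.measurable_fun_sum _ fun σ _ => ?_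
  refine Measurable.const_mul ?_ _
  exact Finset.measurable_fun_prod _ fun i _ => hM _ _

lemma measurable_inv_entries {Ω : Type*} [MeasurableSpace Ω] {A : Ω → GL (Fin d) ℝ}
    (hA : ∀ i j, Measurable fun ω => (A ω : Matrix (Fin d) (Fin d) ℝ) i j) (i j : Fin d) :
    Measurable fun ω => ((A ω)⁻¹ : GL (Fin d) ℝ).val i j := by
  have : ∀ ω, ((A ω)⁻¹ : GL (Fin d) ℝ).val i j =
      (det (A ω).val)⁻¹ * det (((A ω).val).updateRow j (Pi.single i 1)) := by
    intro ω
    rw [Matrix.coe_units_inv, Matrix.inv_def, Matrix.smul_apply, adjugate_apply,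
      Ring.inverse_eq_inv', smul_eq_mul]
  simp_rw [this]
  refine (measurable_det' hA).inv.mul (measurable_det' fun a b => ?_)
  simp only [updateRow_apply]
  split_ifs
  · exact measurable_const
  · exact hA a b

end compound

section os
variable {d : ℕ}

lemma eNorm_eq (x : Fin d → ℝ) : eNorm x = ‖WithLp.toLp 2 x‖ := by
  simp [eNorm, EuclideanSpace.norm_eq]

lemma eNorm_nonneg' (x : Fin d → ℝ) : 0 ≤ eNorm x := Real.sqrt_nonneg _

lemma eNorm_sq (x : Fin d → ℝ) : eNorm x ^ 2 = ∑ i, x i ^ 2 :=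
  Real.sq_sqrt (Finset.sum_nonneg fun _ _ => sq_nonneg _)

lemma eNorm_sq_dot (x : Fin d → ℝ) : eNorm x ^ 2 = x ⬝ᵥ x := by
  rw [eNorm_sq]; simp [dotProduct, sq]

lemma eNorm_add_le (x y : Fin d → ℝ) : eNorm (x + y) ≤ eNorm x + eNorm y := by
  simp only [eNorm_eq, WithLp.toLp_add]
  exact norm_add_le _ _

lemma eNorm_le_of_sq {x y : Fin d → ℝ} (h : ∀ i, x i ^ 2 ≤ y i ^ 2) : eNorm x ≤ eNorm y :=
  Real.sqrt_le_sqrt (Finset.sum_le_sum fun i _ => h i)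

lemma abs_le_eNorm (x : Fin d → ℝ) (i : Fin d) : |x i| ≤ eNorm x := by
  rw [← Real.sqrt_sq_eq_abs]
  exact Real.sqrt_le_sqrt (Finset.single_le_sum (f := fun i => x i ^ 2)
    (fun _ _ => sq_nonneg _) (Finset.mem_univ i))

lemma eNorm_le_sum (x : Fin d → ℝ) : eNorm x ≤ ∑ i, |x i| := by
  have h0 : 0 ≤ ∑ i, |x i| := Finset.sum_nonneg fun _ _ => abs_nonneg _
  refine Real.sqrt_le_iff.2 ⟨h0, ?_⟩
  rw [sq, Finset.sum_mul_sum]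
  refine Finset.sum_le_sum fun i _ => ?_
  have := Finset.single_le_sum (f := fun j => |x i| * |x j|) (s := Finset.univ)
    (fun _ _ => by positivity) (Finset.mem_univ i)
  rw [← sq_abs, sq]; exact this

lemma eNorm_orth {O : Matrix (Fin d) (Fin d) ℝ} (hO : Oᵀ * O = 1) (x : Fin d → ℝ) :
    eNorm (O *ᵥ x) = eNorm x := by
  have : eNorm (O *ᵥ x) ^ 2 = eNorm x ^ 2 := by
    rw [eNorm_sq_dot, eNorm_sq_dot, dotProduct_mulVec, vecMul_mulVec, hO, vecMul_one]
  exact (sq_eq_sq₀ (eNorm_nonneg' _) (eNorm_nonneg' _)).1 this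

lemma eNorm_pos {x : Fin d → ℝ} (hx : x ≠ 0) : 0 < eNorm x := by
  obtain ⟨i, hi⟩ := Function.ne_iff.1 hx
  exact lt_of_lt_of_le (abs_pos.2 hi) (abs_le_eNorm x i)

def Gn (U : ℕ → Matrix (Fin d) (Fin d) ℝ) (g : Fin d → ℝ) (n : ℕ) : Matrix (Fin d) (Fin d) ℝ :=
  U n * diagonal g * (U n)ᵀ

structure Os (U : ℕ → Matrix (Fin d) (Fin d) ℝ) (q : ℕ → Fin d → ℝ) (χ : Fin d → ℝ) : Prop where
  hU : ∀ n, (U n)ᵀ * U n = 1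
  hq0 : ∀ n k, 0 < q n k
  hq : ∀ k, Tendsto (fun n : ℕ => Real.log (q n k) / (2 * n)) atTop (𝓝 (χ k))
  hO : ∀ ε > 0, ∀ᶠ n : ℕ in atTop, ∀ k l,
    |((U n)ᵀ * U (n+1)) k l| ≤ Real.exp (-(|χ k - χ l| - ε) * n)

lemma tendsto_succ_div : Tendsto (fun n : ℕ => ((n:ℝ)+1)/n) atTop (𝓝 1) := by
  have := (tendsto_const_div_atTop_nhds_zero_nat (1:ℝ)).const_add 1
  rw [add_zero] at this
  refine this.congr' ?_
  filter_upwards [eventually_ge_atTop 1] with n hn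
  have : (0:ℝ) < n := by exact_mod_cast hn
  field_simp

theorem Os.mk' {U : ℕ → Matrix (Fin d) (Fin d) ℝ} {q : ℕ → Fin d → ℝ} {χ : Fin d → ℝ}
    (hU : ∀ n, (U n)ᵀ * U n = 1) (hq0 : ∀ n k, 0 < q n k)
    (hq : ∀ k, Tendsto (fun n : ℕ => Real.log (q n k) / (2 * n)) atTop (𝓝 (χ k)))
    {a : ℕ → ℝ} (ha0 : ∀ n, 0 < a n) (ha : Tendsto (fun n : ℕ => Real.log (a n) / n) atTop (𝓝 0))
    (h1 : ∀ n k l, q n k * (((U n)ᵀ * U (n+1)) k l)^2 ≤ a n * q (n+1) l)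
    (h2 : ∀ n k l, q (n+1) l * (((U n)ᵀ * U (n+1)) k l)^2 ≤ a n * q n k) : Os U q χ := by
  refine ⟨hU, hq0, hq, fun ε hε => ?_⟩
  have hq1 : ∀ l, Tendsto (fun n : ℕ => Real.log (q (n+1) l) / (2 * n)) atTop (𝓝 (χ l)) := by
    intro l
    have := ((hq l).comp (tendsto_add_atTop_nat 1)).mul tendsto_succ_div
    rw [mul_one] at this
    refine this.congr' ?_
    filter_upwards [eventually_ge_atTop 1] with n hn
    have : (0:ℝ) < n := by exact_mod_cast hn
    simp only [Function.comp_apply]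
    push_cast
    field_simp
  have key : ∀ k l, ∀ᶠ n : ℕ in atTop,
      |((U n)ᵀ * U (n+1)) k l| ≤ Real.exp (-(|χ k - χ l| - ε) * n) := by
    intro k l
    have t1 := ((ha.div_const 2).add (hq1 l)).sub (hq k)
    have t2 := ((ha.div_const 2).add (hq k)).sub (hq1 l)
    filter_upwards [t1.eventually_lt_const (show 0/2 + χ l - χ k < χ l - χ k + ε by linarith),
      t2.eventually_lt_const (show 0/2 + χ k - χ l < χ k - χ l + ε by linarith),
      eventually_ge_atTop 1] with n e1 e2 hn
    have hn0 : (0:ℝ) < n := by exact_mod_cast hn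
    set o := ((U n)ᵀ * U (n+1)) k l with ho
    have gen : ∀ u v : ℝ, 0 < u → 0 < v → u * o^2 ≤ a n * v → ∀ s,
        Real.log (a n) / n / 2 + Real.log v / (2 * n) - Real.log u / (2 * n) < s →
        |o| ≤ Real.exp (s * n) := by
      intro u v hu hv huv s hs
      have e3 : Real.log (a n) + Real.log v - Real.log u < 2 * (s * n) := by
        have : Real.log (a n) / n / 2 + Real.log v / (2 * n) - Real.log u / (2 * n) =
          (Real.log (a n) + Real.log v - Real.log u) / (2 * n) := by field_simp
        rw [this, div_lt_iff₀ (by positivity)] at hs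
        linarith
      have e4 : o^2 ≤ Real.exp (s * n) ^ 2 := by
        have e5 : o^2 ≤ a n * v / u := by rw [le_div_iff₀ hu]; linarith
        refine e5.trans ?_
        have e6 : a n * v / u = Real.exp (Real.log (a n) + Real.log v - Real.log u) := by
          rw [Real.exp_sub, Real.exp_add, Real.exp_log (ha0 n), Real.exp_log hv, Real.exp_log hu]
        rw [e6, ← Real.exp_nat_mul]
        exact Real.exp_le_exp.2 (by push_cast; linarith)
      exact abs_le_of_sq_le_sq e4 (Real.exp_pos _).le
    rcases abs_cases (χ k - χ l) with h | h
    · rw [h.1]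
      have := gen _ _ (hq0 n k) (hq0 (n+1) l) (h1 n k l) _ e1
      convert this using 3; ring
    · rw [h.1]
      have := gen _ _ (hq0 (n+1) l) (hq0 n k) (h2 n k l) _ e2
      convert this using 3; ring
  exact eventually_all.2 fun k => eventually_all.2 fun l => key k l

variable {U : ℕ → Matrix (Fin d) (Fin d) ℝ} {q : ℕ → Fin d → ℝ} {χ : Fin d → ℝ}

lemma Os.hU' (H : Os U q χ) (n : ℕ) : U n * (U n)ᵀ = 1 := mul_eq_one_comm.1 (H.hU n)

lemma orth_entry {V : Matrix (Fin d) (Fin d) ℝ} (hV : Vᵀ * V = 1) (i j : Fin d) : |V i j| ≤ 1 := by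
  have h := congrFun (congrFun hV j) j
  simp only [mul_apply, transpose_apply, one_apply_eq] at h
  have h2 := Finset.single_le_sum (f := fun i => V i j * V i j) (s := Finset.univ)
    (fun i _ => mul_self_nonneg _) (Finset.mem_univ i)
  rw [h] at h2
  exact abs_le_of_sq_le_sq (by nlinarith) zero_le_one |>.trans le_rfl

lemma Os.Gn_conv (H : Os U q χ) {g : Fin d → ℝ} (hg : ∀ k l, χ k = χ l → g k = g l) :
    ∃ G, Tendsto (Gn U g) atTop (𝓝 G) := by
  have hentry : ∀ i j, ∃ z, Tendsto (fun n => Gn U g n i j) atTop (𝓝 z) := by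
    intro i j
    apply cauchySeq_tendsto_of_complete
    apply cauchySeq_of_summable_dist
    have hs : Summable fun n : ℕ => ∑ k, ∑ l, |g l - g k| * |((U n)ᵀ * U (n+1)) k l| := by
      refine summable_sum fun k _ => summable_sum fun l _ => ?_
      by_cases hkl : χ k = χ l
      · simp only [hg k l hkl, sub_self, abs_zero, zero_mul]; exact summable_zero
      · have hpos : 0 < |χ k - χ l| := abs_pos.2 (sub_ne_zero.2 hkl)
        apply Summable.mul_left
        refine Summable.of_norm_bounded_eventually_nat
          (g := fun n : ℕ => Real.exp (-(|χ k - χ l| - |χ k - χ l|/2)) ^ n)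
          (summable_geometric_of_lt_one (Real.exp_pos _).le
            (Real.exp_lt_one_iff.2 (by linarith))) ?_
        filter_upwards [H.hO (|χ k - χ l|/2) (by linarith)] with n hn
        rw [Real.norm_eq_abs, abs_abs, ← Real.exp_nat_mul]
        refine (hn k l).trans (le_of_eq ?_)
        congr 1; ring
    refine Summable.of_nonneg_of_le (fun _ => dist_nonneg) (fun n => ?_) hs
    have e : Gn U g (n+1) - Gn U g n = U n * (((U n)ᵀ * U (n+1)) * diagonal g -
        diagonal g * ((U n)ᵀ * U (n+1))) * (U (n+1))ᵀ := by
      unfold Gn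
      rw [mul_sub, sub_mul]
      congr 1
      · simp only [← mul_assoc]; rw [H.hU', one_mul]
      · simp only [mul_assoc]; rw [H.hU', mul_one]
    rw [dist_comm, Real.dist_eq]
    have e2 : Gn U g (n+1) i j - Gn U g n i j = (Gn U g (n+1) - Gn U g n) i j := rfl
    rw [e2, e, Matrix.mul_apply]
    simp only [Matrix.mul_apply (M := U n), Finset.sum_mul]
    rw [Finset.sum_comm]
    refine (Finset.abs_sum_le_sum_abs _ _).trans (Finset.sum_le_sum fun k _ => ?_)
    refine (Finset.abs_sum_le_sum_abs _ _).trans (Finset.sum_le_sum fun l _ => ?_)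
    rw [Matrix.sub_apply, mul_diagonal, diagonal_mul, transpose_apply]
    have e3 : U n i k * (((U n)ᵀ * U (n+1)) k l * g l - g k * ((U n)ᵀ * U (n+1)) k l) * U (n+1) j l
      = U n i k * U (n+1) j l * ((g l - g k) * ((U n)ᵀ * U (n+1)) k l) := by ring
    rw [e3, abs_mul, abs_mul, abs_mul]
    have b1 := orth_entry (H.hU n) i k
    have b2 := orth_entry (H.hU (n+1)) j l
    have b3 : |U n i k| * |U (n+1) j l| ≤ 1 := mul_le_one₀ b1 (abs_nonneg _) b2
    exact mul_le_of_le_one_left (by positivity) b3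
  choose z hz using hentry
  exact ⟨z, tendsto_pi_nhds.2 fun i => tendsto_pi_nhds.2 fun j => hz i j⟩

end os



section os2
variable {d : ℕ}
variable {U : ℕ → Matrix (Fin d) (Fin d) ℝ} {q : ℕ → Fin d → ℝ} {χ : Fin d → ℝ}

def yq (U : ℕ → Matrix (Fin d) (Fin d) ℝ) (q : ℕ → Fin d → ℝ) (n : ℕ) (x : Fin d → ℝ) : ℝ :=
  ∑ k, q n k * (((U n)ᵀ *ᵥ x) k)^2

def pw (U : ℕ → Matrix (Fin d) (Fin d) ℝ) (χ : Fin d → ℝ) (b : ℝ) (x : Fin d → ℝ) (n : ℕ) :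
    Fin d → ℝ := fun k => if b ≤ χ k then ((U n)ᵀ *ᵥ x) k else 0

lemma Os.eNorm_Gn (H : Os U q χ) (g : Fin d → ℝ) (n : ℕ) (x : Fin d → ℝ) :
    eNorm (Gn U g n *ᵥ x) = eNorm (fun k => g k * ((U n)ᵀ *ᵥ x) k) := by
  unfold Gn
  rw [← mulVec_mulVec, ← mulVec_mulVec, eNorm_orth (H.hU n)]
  congr 1
  ext k
  rw [mulVec_diagonal]

lemma Os.eNorm_w (H : Os U q χ) (n : ℕ) (x : Fin d → ℝ) : eNorm ((U n)ᵀ *ᵥ x) = eNorm x :=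
  eNorm_orth (by rw [transpose_transpose]; exact H.hU' n) x

lemma continuous_eNorm : Continuous (eNorm : (Fin d → ℝ) → ℝ) := by
  unfold eNorm; fun_prop

lemma tendsto_eNorm_mulVec {M : ℕ → Matrix (Fin d) (Fin d) ℝ} {X : Matrix (Fin d) (Fin d) ℝ}
    (h : Tendsto M atTop (𝓝 X)) (x : Fin d → ℝ) :
    Tendsto (fun n => eNorm (M n *ᵥ x)) atTop (𝓝 (eNorm (X *ᵥ x))) := by
  have hc : Continuous fun M : Matrix (Fin d) (Fin d) ℝ => eNorm (M *ᵥ x) :=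
    continuous_eNorm.comp (by fun_prop)
  exact (hc.tendsto X).comp h

lemma yq_nonneg (H : Os U q χ) (n : ℕ) (x : Fin d → ℝ) : 0 ≤ yq U q n x :=
  Finset.sum_nonneg fun k _ => mul_nonneg (H.hq0 n k).le (sq_nonneg _)

lemma yq_pos (H : Os U q χ) (n : ℕ) {x : Fin d → ℝ} (hx : x ≠ 0) : 0 < yq U q n x := by
  have h1 : (U n)ᵀ *ᵥ x ≠ 0 := by
    intro h0
    apply hx
    have := congrArg (fun v => U n *ᵥ v) h0
    simpa [mulVec_mulVec, H.hU' n] using this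
  obtain ⟨k, hk⟩ := Function.ne_iff.1 h1
  refine Finset.sum_pos' (fun k _ => mul_nonneg (H.hq0 n k).le (sq_nonneg _))
    ⟨k, Finset.mem_univ k, mul_pos (H.hq0 n k) (lt_of_le_of_ne (sq_nonneg _) (Ne.symm (pow_ne_zero 2 hk)))⟩

lemma Os.lower (H : Os U q χ) {b : ℝ} {X : Matrix (Fin d) (Fin d) ℝ}
    (hX : Tendsto (Gn U fun k => if b ≤ χ k then 1 else 0) atTop (𝓝 X)) {x : Fin d → ℝ}
    (hx : X *ᵥ x ≠ 0) {e : ℝ} (he : e < b) :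
    ∀ᶠ n : ℕ in atTop, e < Real.log (yq U q n x) / (2 * n) := by
  obtain ⟨e', h1, h2⟩ := exists_between he
  set s := eNorm (X *ᵥ x) with hs
  have hs0 : 0 < s := eNorm_pos hx
  have t1 := (tendsto_eNorm_mulVec hX x).eventually_const_lt (show s/2 < s by linarith)
  have t2 : ∀ᶠ n : ℕ in atTop, ∀ k, b ≤ χ k → e' < Real.log (q n k) / (2 * n) :=
    eventually_all.2 fun k => by
      by_cases hk : b ≤ χ k
      · filter_upwards [(H.hq k).eventually_const_lt (lt_of_lt_of_le h2 hk)] with n hn _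
        exact hn
      · exact Eventually.of_forall fun n h => absurd h hk
  have t3 : Tendsto (fun n : ℕ => e' + Real.log (s/2) / n) atTop (𝓝 (e' + 0)) :=
    (tendsto_const_div_atTop_nhds_zero_nat _).const_add _
  rw [add_zero] at t3
  filter_upwards [t1, t2, t3.eventually_const_lt h1, eventually_ge_atTop 1] with n a1 a2 a3 hn
  have hn0 : (0:ℝ) < n := by exact_mod_cast hn
  refine a3.trans_le ?_
  rw [le_div_iff₀ (by positivity)]
  have e1 : Real.exp (2 * n * e') * (s/2)^2 ≤ yq U q n x := by
    have : (s/2)^2 ≤ eNorm (Gn U (fun k => if b ≤ χ k then 1 else 0) n *ᵥ x) ^ 2 :=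
      pow_le_pow_left₀ (by positivity) a1.le 2
    refine (mul_le_mul_of_nonneg_left this (Real.exp_pos _).le).trans ?_
    rw [H.eNorm_Gn, eNorm_sq, Finset.mul_sum]
    refine Finset.sum_le_sum fun k _ => ?_
    by_cases hk : b ≤ χ k
    · simp only [hk, if_true, one_mul]
      refine mul_le_mul_of_nonneg_right ?_ (sq_nonneg _)
      have := a2 k hk
      rw [lt_div_iff₀ (by positivity)] at this
      rw [← Real.exp_log (H.hq0 n k)]
      exact Real.exp_le_exp.2 (by linarith)
    · simp only [hk, if_false, zero_mul]
      have := mul_nonneg (H.hq0 n k).le (sq_nonneg (((U n)ᵀ *ᵥ x) k))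
      simpa using this
  have e2 := Real.log_le_log (by positivity) e1
  rw [Real.log_mul (by positivity) (by positivity), Real.log_exp, Real.log_pow] at e2
  push_cast at e2
  have : (e' + Real.log (s / 2) / n) * (2 * n) = 2 * n * e' + 2 * Real.log (s/2) := by
    field_simp
  linarith

lemma tail_bound {S : ℕ → ℝ} {C r : ℝ} (hr0 : 0 ≤ r) (hr : r < 1)
    (hS : Tendsto S atTop (𝓝 0)) {n₀ : ℕ} (h : ∀ n ≥ n₀, S n ≤ S (n+1) + C * r^n) :
    ∀ n ≥ n₀, S n ≤ C / (1 - r) * r^n := by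
  have h1r : 0 < 1 - r := by linarith
  intro n hn
  have hmono : ∀ m, S n - C / (1 - r) * r^n ≤ S (n+m) - C/(1-r) * r^(n+m) := by
    intro m
    induction m with
    | zero => simp
    | succ m ih =>
      refine ih.trans ?_
      have := h (n+m) (by omega)
      have e : C * r^(n+m) = C/(1-r) * r^(n+m) - C/(1-r) * r^(n+(m+1)) := by
        field_simp; ring
      rw [← add_assoc] at e ⊢
      linarith
  have hlim : Tendsto (fun m => S (n+m) - C/(1-r) * r^(n+m)) atTop (𝓝 0) := by
    have t1 : Tendsto (fun m => n + m) atTop atTop := tendsto_atTop_mono (fun m => Nat.le_add_left m n) tendsto_id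
    have := (hS.comp t1).sub (((tendsto_pow_atTop_nhds_zero_of_lt_one hr0 hr).const_mul (C/(1-r))).comp t1)
    simpa using this
  have := ge_of_tendsto' hlim hmono
  linarith

lemma Os.recur (H : Os U q χ) (b : ℝ) (x : Fin d → ℝ) (n : ℕ) :
    eNorm (pw U χ b x n) ≤ eNorm (pw U χ b x (n+1)) +
      ∑ k, ∑ l, (if b ≤ χ k ∧ χ l < b then
        |((U n)ᵀ * U (n+1)) k l| * |((U (n+1))ᵀ *ᵥ x) l| else 0) := by
  set O := (U n)ᵀ * U (n+1) with hOdef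
  have hO : Oᵀ * O = 1 := by
    rw [hOdef, transpose_mul, transpose_transpose, mul_assoc, ← mul_assoc (U n), H.hU', one_mul, H.hU]
  have hw : (U n)ᵀ *ᵥ x = O *ᵥ ((U (n+1))ᵀ *ᵥ x) := by
    rw [mulVec_mulVec, hOdef, mul_assoc, H.hU', mul_one]
  set w := (U (n+1))ᵀ *ᵥ x with hwdef
  have e : pw U χ b x n = (fun k => if b ≤ χ k then (O *ᵥ pw U χ b x (n+1)) k else 0) +
      (fun k => if b ≤ χ k then ∑ l, (if χ l < b then O k l * w l else 0) else 0) := by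
    ext k
    simp only [Pi.add_apply]
    by_cases hk : b ≤ χ k
    · have hwk : ((U n)ᵀ *ᵥ x) k = ∑ l, O k l * w l := by rw [hw]; rfl
      have hpk : (O *ᵥ pw U χ b x (n+1)) k = ∑ l, O k l * (if b ≤ χ l then w l else 0) := rfl
      rw [hpk]
      simp only [pw, hk, if_true, hwk]
      rw [← Finset.sum_add_distrib]
      refine Finset.sum_congr rfl fun l _ => ?_
      by_cases hl : b ≤ χ l
      · simp only [hl, if_true, not_lt.2 hl, if_false, add_zero]
      · simp only [hl, if_false, not_le.1 hl, if_true, mul_zero, zero_add]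
    · simp [pw, hk]
  rw [e]
  refine (eNorm_add_le _ _).trans (add_le_add ?_ ?_)
  · rw [← eNorm_orth hO (pw U χ b x (n+1))]
    refine eNorm_le_of_sq fun k => ?_
    split_ifs
    · exact le_rfl
    · simpa using sq_nonneg _
  · refine (eNorm_le_sum _).trans (Finset.sum_le_sum fun k _ => ?_)
    by_cases hk : b ≤ χ k
    · simp only [hk, if_true, true_and]
      refine (Finset.abs_sum_le_sum_abs _ _).trans (Finset.sum_le_sum fun l _ => ?_)
      split_ifs
      · rw [abs_mul]
      · simp
    · simp [hk]

lemma abs_w_le (b : ℝ) (x : Fin d → ℝ) (n : ℕ) {k : Fin d} (hk : b ≤ χ k) :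
    |((U n)ᵀ *ᵥ x) k| ≤ eNorm (pw U χ b x n) := by
  have := abs_le_eNorm (pw U χ b x n) k
  simpa [pw, hk] using this

lemma Os.upper_aux (H : Os U q χ) {c : ℝ} {X : Matrix (Fin d) (Fin d) ℝ}
    (hX : Tendsto (Gn U fun k => if c < χ k then 1 else 0) atTop (𝓝 X)) {x : Fin d → ℝ}
    (hx : X *ᵥ x = 0) (N : ℕ) : ∀ b, c < b → (Finset.univ.filter fun k => χ k < b).card = N →
    ∀ ε > 0, (fun n => eNorm (pw U χ b x n)) =O[atTop]
      (fun n : ℕ => Real.exp (-(b - c - ε) * n)) := by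
  induction N using Nat.strong_induction_on with
  | _ N ih =>
  intro b hb hN ε hε
  have hxb : ∀ n, eNorm (pw U χ b x n) ≤ eNorm x := fun n => by
    rw [← H.eNorm_w n x]
    refine eNorm_le_of_sq fun k => ?_
    simp only [pw]; split_ifs
    · exact le_rfl
    · simpa using sq_nonneg _
  by_cases hη : b - c - ε ≤ 0
  · refine Asymptotics.IsBigO.of_bound (eNorm x) (Eventually.of_forall fun n => ?_)
    rw [Real.norm_eq_abs, abs_of_nonneg (eNorm_nonneg' _), Real.norm_eq_abs, Real.abs_exp]
    have hh : 0 ≤ -(b - c - ε) := by linarith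
    have : 1 ≤ Real.exp (-(b - c - ε) * n) :=
      Real.one_le_exp (mul_nonneg hh (Nat.cast_nonneg n))
    nlinarith [hxb n, eNorm_nonneg' x]
  push Not at hη
  have hS0 : Tendsto (fun n => eNorm (pw U χ b x n)) atTop (𝓝 0) := by
    have t := tendsto_eNorm_mulVec hX x
    rw [hx] at t
    have e0 : eNorm (0 : Fin d → ℝ) = 0 := by simp [eNorm]
    rw [e0] at t
    refine squeeze_zero (fun n => eNorm_nonneg' _) (fun n => ?_) t
    rw [H.eNorm_Gn]
    refine eNorm_le_of_sq fun k => ?_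
    simp only [pw]
    by_cases h1 : b ≤ χ k
    · have h2 : c < χ k := lt_of_lt_of_le hb h1
      simp [h1, h2]
    · simp only [h1, if_false]; rw [zero_pow two_ne_zero]; exact sq_nonneg _
  have herr : (fun n : ℕ => ∑ k, ∑ l, (if b ≤ χ k ∧ χ l < b then
        |((U n)ᵀ * U (n+1)) k l| * |((U (n+1))ᵀ *ᵥ x) l| else 0)) =O[atTop]
      (fun n : ℕ => Real.exp (-(b - c - ε) * n)) := by
    refine Asymptotics.IsBigO.fun_sum fun k _ => Asymptotics.IsBigO.fun_sum fun l _ => ?_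
    by_cases hkl : b ≤ χ k ∧ χ l < b
    · simp only [hkl, and_self, if_true]
      have o1 : (fun n : ℕ => |((U n)ᵀ * U (n+1)) k l|) =O[atTop]
          (fun n : ℕ => Real.exp (-(b - χ l - ε/2) * n)) := by
        refine Asymptotics.IsBigO.of_bound 1 ?_
        filter_upwards [H.hO (ε/2) (by linarith)] with n hn
        rw [Real.norm_eq_abs, abs_abs, Real.norm_eq_abs, Real.abs_exp, one_mul]
        refine (hn k l).trans (Real.exp_le_exp.2 ?_)
        refine mul_le_mul_of_nonneg_right ?_ (by positivity)
        have := le_abs_self (χ k - χ l)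
        linarith [hkl.1]
      have o2 : (fun n : ℕ => |((U (n+1))ᵀ *ᵥ x) l|) =O[atTop]
          (fun n : ℕ => Real.exp (-(χ l - c - ε/2) * n)) := by
        by_cases hl : c < χ l
        · have hcard : (Finset.univ.filter fun k => χ k < χ l).card < N := by
            rw [← hN]
            apply Finset.card_lt_card
            rw [Finset.ssubset_iff_of_subset]
            · exact ⟨l, by simp [hkl.2], by simp⟩
            · intro i hi
              simp only [Finset.mem_filter, Finset.mem_univ, true_and] at hi ⊢
              exact hi.trans hkl.2
          have := (ih _ hcard (χ l) hl rfl (ε/2) (by linarith)).comp_tendsto (tendsto_add_atTop_nat 1)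
          have o3 : (fun n : ℕ => |((U (n+1))ᵀ *ᵥ x) l|) =O[atTop]
              ((fun n : ℕ => eNorm (pw U χ (χ l) x n)) ∘ fun n => n + 1) := by
            refine Asymptotics.IsBigO.of_bound 1 (Eventually.of_forall fun n => ?_)
            rw [Real.norm_eq_abs, abs_abs, Real.norm_eq_abs, one_mul]
            exact (abs_w_le (χ l) x (n+1) le_rfl).trans (le_abs_self _)
          refine (o3.trans this).trans ?_
          refine Asymptotics.IsBigO.of_bound (Real.exp (-(χ l - c - ε/2)))
            (Eventually.of_forall fun n => ?_)
          simp only [Function.comp_apply]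
          rw [Real.norm_eq_abs, Real.abs_exp, Real.norm_eq_abs, Real.abs_exp, ← Real.exp_add]
          refine Real.exp_le_exp.2 (le_of_eq ?_)
          push_cast; ring
        · refine Asymptotics.IsBigO.of_bound (eNorm x) (Eventually.of_forall fun n => ?_)
          rw [Real.norm_eq_abs, abs_abs, Real.norm_eq_abs, Real.abs_exp]
          have hh : 0 ≤ -(χ l - c - ε/2) := by linarith [not_lt.1 hl]
          have h1 : 1 ≤ Real.exp (-(χ l - c - ε/2) * n) :=
            Real.one_le_exp (mul_nonneg hh (Nat.cast_nonneg n))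
          have h2 := abs_le_eNorm ((U (n+1))ᵀ *ᵥ x) l
          rw [H.eNorm_w] at h2
          nlinarith [eNorm_nonneg' x]
      refine (o1.mul o2).congr_right fun n => ?_
      rw [← Real.exp_add]
      congr 1; ring
    · simp only [hkl, if_false]
      exact Asymptotics.isBigO_zero _ _
  obtain ⟨C, hC⟩ := herr.bound
  obtain ⟨n₀, hn₀⟩ := eventually_atTop.1 hC
  have hrec : ∀ n ≥ n₀, eNorm (pw U χ b x n) ≤ eNorm (pw U χ b x (n+1)) +
      C * Real.exp (-(b - c - ε)) ^ n := by
    intro n hn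
    refine (H.recur b x n).trans (add_le_add le_rfl ?_)
    have := hn₀ n hn
    rw [Real.norm_eq_abs, Real.norm_eq_abs, Real.abs_exp] at this
    refine (le_abs_self _).trans (this.trans (le_of_eq ?_))
    rw [← Real.exp_nat_mul]
    congr 2; ring
  have hfin := tail_bound (Real.exp_pos _).le (Real.exp_lt_one_iff.2 (by linarith)) hS0 hrec
  refine Asymptotics.IsBigO.of_bound (C / (1 - Real.exp (-(b - c - ε)))) ?_
  filter_upwards [eventually_ge_atTop n₀] with n hn
  rw [Real.norm_eq_abs, abs_of_nonneg (eNorm_nonneg' _), Real.norm_eq_abs, Real.abs_exp]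
  refine (hfin n hn).trans (le_of_eq ?_)
  rw [← Real.exp_nat_mul]
  congr 2; ring

lemma Os.upper (H : Os U q χ) {c : ℝ} {X : Matrix (Fin d) (Fin d) ℝ}
    (hX : Tendsto (Gn U fun k => if c < χ k then 1 else 0) atTop (𝓝 X)) {x : Fin d → ℝ}
    (hx : X *ᵥ x = 0) (hx0 : x ≠ 0) {e : ℝ} (he : c < e) :
    ∀ᶠ n : ℕ in atTop, Real.log (yq U q n x) / (2 * n) < e := by
  set ε := (e - c)/4 with hεd
  have hε : 0 < ε := by rw [hεd]; linarith
  have hy : (fun n => yq U q n x) =O[atTop] (fun n : ℕ => Real.exp (2 * (c + 2*ε) * n)) := by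
    unfold yq
    refine Asymptotics.IsBigO.fun_sum fun k _ => ?_
    have o1 : (fun n => q n k) =O[atTop] (fun n : ℕ => Real.exp (2 * (χ k + ε) * n)) := by
      refine Asymptotics.IsBigO.of_bound 1 ?_
      filter_upwards [(H.hq k).eventually_lt_const (show χ k < χ k + ε by linarith),
        eventually_ge_atTop 1] with n hn hn1
      have hn0 : (0:ℝ) < n := by exact_mod_cast hn1
      rw [Real.norm_eq_abs, abs_of_pos (H.hq0 n k), Real.norm_eq_abs, Real.abs_exp, one_mul]
      rw [div_lt_iff₀ (by positivity)] at hn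
      rw [← Real.exp_log (H.hq0 n k)]
      exact Real.exp_le_exp.2 (by linarith)
    by_cases hk : c < χ k
    · have o2 := H.upper_aux hX hx _ (χ k) hk rfl ε hε
      have o3 : (fun n : ℕ => ((U n)ᵀ *ᵥ x) k) =O[atTop]
          (fun n : ℕ => Real.exp (-(χ k - c - ε) * n)) := by
        refine Asymptotics.IsBigO.trans (Asymptotics.IsBigO.of_bound 1
          (Eventually.of_forall fun n => ?_)) o2
        rw [Real.norm_eq_abs, Real.norm_eq_abs, one_mul]
        exact (abs_w_le (χ k) x n le_rfl).trans (le_abs_self _)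
      refine (o1.mul (o3.pow 2)).congr_right fun n => ?_
      rw [← Real.exp_nat_mul, ← Real.exp_add]
      congr 1; push_cast; ring
    · have o3 : (fun n : ℕ => ((U n)ᵀ *ᵥ x) k) =O[atTop]
          (fun n : ℕ => (1:ℝ)) := by
        refine Asymptotics.IsBigO.of_bound (eNorm x) (Eventually.of_forall fun n => ?_)
        have h2 := abs_le_eNorm ((U n)ᵀ *ᵥ x) k
        rw [H.eNorm_w] at h2
        simpa using h2
      refine (o1.mul (o3.pow 2)).trans (Asymptotics.IsBigO.of_bound 1
        (Eventually.of_forall fun n => ?_))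
      rw [one_pow, mul_one, one_mul, Real.norm_eq_abs, Real.abs_exp, Real.norm_eq_abs, Real.abs_exp]
      refine Real.exp_le_exp.2 (mul_le_mul_of_nonneg_right ?_ (by positivity))
      linarith [not_lt.1 hk]
  obtain ⟨C, hC0, hC⟩ := hy.exists_pos
  have t3 : Tendsto (fun n : ℕ => (c + 2*ε) + (Real.log C / 2) / n) atTop (𝓝 ((c + 2*ε) + 0)) :=
    (tendsto_const_div_atTop_nhds_zero_nat _).const_add _
  rw [add_zero] at t3
  filter_upwards [hC.bound, t3.eventually_lt_const (show c + 2*ε < e by rw [hεd]; linarith),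
    eventually_ge_atTop 1] with n h1 h2 hn
  have hn0 : (0:ℝ) < n := by exact_mod_cast hn
  refine lt_of_le_of_lt ?_ h2
  rw [div_le_iff₀ (by positivity)]
  rw [Real.norm_eq_abs, Real.norm_eq_abs, Real.abs_exp] at h1
  have h3 := Real.log_le_log (yq_pos H n hx0) ((le_abs_self _).trans h1)
  rw [Real.log_mul hC0.ne' (Real.exp_pos _).ne', Real.log_exp] at h3
  have : (c + 2 * ε + Real.log C / 2 / n) * (2 * n) = Real.log C + 2 * (c + 2*ε) * n := by
    field_simp; ring
  linarith

end os2



section os3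
variable {d : ℕ}
variable {U : ℕ → Matrix (Fin d) (Fin d) ℝ} {q : ℕ → Fin d → ℝ} {χ : Fin d → ℝ}

def Os.G (H : Os U q χ) (h : ℝ → ℝ) : Matrix (Fin d) (Fin d) ℝ :=
  (H.Gn_conv (g := fun k => h (χ k)) (fun _ _ e => by simp only [e])).choose

lemma Os.G_spec (H : Os U q χ) (h : ℝ → ℝ) :
    Tendsto (Gn U fun k => h (χ k)) atTop (𝓝 (H.G h)) :=
  (H.Gn_conv (g := fun k => h (χ k)) (fun _ _ e => by simp only [e])).choose_spec

lemma Os.G_congr (H : Os U q χ) {h k : ℝ → ℝ} (e : ∀ j, h (χ j) = k (χ j)) : H.G h = H.G k := by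
  refine tendsto_nhds_unique (H.G_spec h) ?_
  have : (fun j => h (χ j)) = fun j => k (χ j) := funext e
  rw [this]; exact H.G_spec k

lemma Os.G_mul (H : Os U q χ) (h k : ℝ → ℝ) : H.G h * H.G k = H.G (fun t => h t * k t) := by
  refine tendsto_nhds_unique ((H.G_spec h).mul (H.G_spec k)) ?_
  refine (H.G_spec _).congr fun n => ?_
  unfold Gn
  have : U n * diagonal (fun k => h (χ k)) * (U n)ᵀ * (U n * diagonal (fun j => k (χ j)) * (U n)ᵀ)
    = U n * diagonal (fun k => h (χ k)) * ((U n)ᵀ * U n) * diagonal (fun j => k (χ j)) * (U n)ᵀ := by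
    simp only [mul_assoc]
  rw [this, H.hU, mul_one, mul_assoc (U n) (diagonal _) (diagonal _), diagonal_mul_diagonal]

lemma Os.G_add (H : Os U q χ) (h k : ℝ → ℝ) : H.G h + H.G k = H.G (fun t => h t + k t) := by
  refine tendsto_nhds_unique ((H.G_spec h).add (H.G_spec k)) ?_
  refine (H.G_spec _).congr fun n => ?_
  unfold Gn
  rw [← add_mul, ← mul_add, diagonal_add]

lemma Os.G_smul (H : Os U q χ) (c : ℝ) (h : ℝ → ℝ) : c • H.G h = H.G (fun t => c * h t) := by
  refine tendsto_nhds_unique ((H.G_spec h).const_smul c) ?_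
  refine (H.G_spec _).congr fun n => ?_
  unfold Gn
  rw [← Matrix.smul_mul, ← Matrix.mul_smul, ← diagonal_smul]
  rfl

lemma Os.G_one (H : Os U q χ) : H.G (fun _ => 1) = 1 := by
  refine tendsto_nhds_unique (H.G_spec _) ?_
  refine tendsto_const_nhds.congr fun n => ?_
  unfold Gn
  rw [diagonal_one, mul_one, H.hU']

lemma Os.G_zero (H : Os U q χ) : H.G (fun _ => 0) = 0 := by
  have := H.G_smul 0 (fun _ => 1)
  simp only [zero_smul, zero_mul] at this
  exact this.symm

lemma Os.G_sum (H : Os U q χ) (s : Finset ℝ) (h : ℝ → ℝ → ℝ) :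
    ∑ a ∈ s, H.G (h a) = H.G (fun t => ∑ a ∈ s, h a t) := by
  induction s using Finset.induction_on with
  | empty => simpa using H.G_zero.symm
  | insert a s ha ih =>
    rw [Finset.sum_insert ha, ih, H.G_add]
    simp only [Finset.sum_insert ha]

lemma Os.G_symm (H : Os U q χ) (h : ℝ → ℝ) : (H.G h)ᵀ = H.G h := by
  have hc : Continuous fun M : Matrix (Fin d) (Fin d) ℝ => Mᵀ := by fun_prop
  refine tendsto_nhds_unique ((hc.tendsto _).comp (H.G_spec h)) ?_
  refine (H.G_spec _).congr fun n => ?_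
  simp [Gn, transpose_mul, mul_assoc]

lemma Os.G_trace (H : Os U q χ) (h : ℝ → ℝ) : (H.G h).trace = ∑ j, h (χ j) := by
  have hc : Continuous fun M : Matrix (Fin d) (Fin d) ℝ => M.trace := by fun_prop
  refine tendsto_nhds_unique ((hc.tendsto _).comp (H.G_spec h)) ?_
  refine tendsto_const_nhds.congr fun n => ?_
  simp only [Gn, Function.comp_apply]
  rw [trace_mul_comm, ← mul_assoc, H.hU, one_mul, trace_diagonal]

lemma Os.kill (H : Os U q χ) {x : Fin d → ℝ} {μ : ℝ} (hx : H.G Real.exp *ᵥ x = μ • x)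
    {k : ℝ → ℝ} (hk : ∀ j, Real.exp (χ j) = μ → k (χ j) = 0) : H.G k *ᵥ x = 0 := by
  have e : H.G k = H.G (fun t => k t / (Real.exp t - μ)) * H.G Real.exp +
      (-μ) • H.G (fun t => k t / (Real.exp t - μ)) := by
    rw [H.G_mul, H.G_smul, H.G_add]
    refine H.G_congr fun j => ?_
    by_cases hj : Real.exp (χ j) = μ
    · rw [hk j hj]; simp
    · have : Real.exp (χ j) - μ ≠ 0 := sub_ne_zero.2 hj
      field_simp
      ring
  rw [e, add_mulVec, ← mulVec_mulVec, hx, mulVec_smul, smul_mulVec]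
  simp

lemma Os.mem_eig (H : Os U q χ) (a : ℝ) (y : Fin d → ℝ) :
    H.G Real.exp *ᵥ (H.G (fun t => if t = a then 1 else 0) *ᵥ y) =
      Real.exp a • (H.G (fun t => if t = a then 1 else 0) *ᵥ y) := by
  rw [mulVec_mulVec, H.G_mul, ← smul_mulVec, H.G_smul]
  congr 1
  refine H.G_congr fun j => ?_
  by_cases h : χ j = a <;> simp [h]

lemma mem_eigenspace_iff' {M : Matrix (Fin d) (Fin d) ℝ} {μ : ℝ} {x : Fin d → ℝ} :
    x ∈ Module.End.eigenspace (Matrix.toLin' M) μ ↔ M *ᵥ x = μ • x := by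
  rw [Module.End.mem_eigenspace_iff, toLin'_apply]

/-- limit statement for squared lengths -/
def Ly (U : ℕ → Matrix (Fin d) (Fin d) ℝ) (q : ℕ → Fin d → ℝ) (x : Fin d → ℝ) (l : ℝ) : Prop :=
  Tendsto (fun n : ℕ => Real.log (yq U q n x) / (2 * n)) atTop (𝓝 l)

lemma Os.ly_of (H : Os U q χ) {x : Fin d → ℝ} {b : ℝ}
    (h1 : H.G (fun t => if b ≤ t then 1 else 0) *ᵥ x ≠ 0)
    (h2 : H.G (fun t => if b < t then 1 else 0) *ᵥ x = 0) : Ly U q x b := by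
  have hx0 : x ≠ 0 := by rintro rfl; exact h1 (mulVec_zero _)
  refine tendsto_order.2 ⟨fun e he => ?_, fun e he => ?_⟩
  · exact H.lower (H.G_spec (fun t => if b ≤ t then 1 else 0)) h1 he
  · exact H.upper (H.G_spec (fun t => if b < t then 1 else 0)) h2 hx0 he

lemma Os.exists_ly (H : Os U q χ) {x : Fin d → ℝ} (hx : x ≠ 0) :
    ∃ l ∈ Finset.univ.image χ, H.G (fun t => if l ≤ t then 1 else 0) *ᵥ x ≠ 0 ∧
      H.G (fun t => if l < t then 1 else 0) *ᵥ x = 0 := by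
  classical
  set F := (Finset.univ.image χ).filter fun l =>
    H.G (fun t => if l ≤ t then 1 else 0) *ᵥ x ≠ 0 with hF
  have hne : (Finset.univ.image χ).Nonempty := by
    obtain ⟨i, _⟩ := Function.ne_iff.1 hx
    exact ⟨χ i, by simp⟩
  have hFne : F.Nonempty := by
    refine ⟨(Finset.univ.image χ).min' hne, ?_⟩
    rw [hF, Finset.mem_filter]
    refine ⟨Finset.min'_mem _ _, ?_⟩
    have : H.G (fun t => if (Finset.univ.image χ).min' hne ≤ t then 1 else 0) = 1 := by
      rw [← H.G_one]
      refine H.G_congr fun j => if_pos ?_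
      exact Finset.min'_le _ _ (by simp)
    rw [this, one_mulVec]; exact hx
  have hm := Finset.max'_mem F hFne
  set l := F.max' hFne with hl
  rw [hF, Finset.mem_filter] at hm
  refine ⟨l, hm.1, hm.2, ?_⟩
  by_contra hcon
  set E' := (Finset.univ.image χ).filter fun t => l < t with hE'
  have hE'ne : E'.Nonempty := by
    by_contra h
    rw [Finset.not_nonempty_iff_eq_empty] at h
    apply hcon
    have : H.G (fun t => if l < t then 1 else 0) = 0 := by
      rw [← H.G_zero]
      refine H.G_congr fun j => if_neg fun hj => ?_
      have : χ j ∈ E' := by simp [hE', hj]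
      rw [h] at this; simp at this
    rw [this, zero_mulVec]
  have hm' := Finset.min'_mem E' hE'ne
  have hle := Finset.min'_le E'
  set m := E'.min' hE'ne with hmdef
  rw [hE', Finset.mem_filter] at hm'
  have : H.G (fun t => if l < t then 1 else 0) = H.G (fun t => if m ≤ t then 1 else 0) := by
    refine H.G_congr fun j => ?_
    have : l < χ j ↔ m ≤ χ j :=
      ⟨fun h => hle _ (by simp [hE', h]), fun h => lt_of_lt_of_le hm'.2 h⟩
    simp only [this]
  rw [this] at hcon
  have : m ∈ F := by rw [hF, Finset.mem_filter]; exact ⟨hm'.1, hcon⟩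
  have := Finset.le_max' F m this
  linarith [hm'.2]

lemma Os.filt (H : Os U q χ) (c : ℝ) (x : Fin d → ℝ) :
    (x ∈ ⨆ a ∈ Finset.univ.image χ, ⨆ _ : a ≤ c,
      Module.End.eigenspace (Matrix.toLin' (H.G Real.exp)) (Real.exp a)) ↔
      H.G (fun t => if c < t then 1 else 0) *ᵥ x = 0 := by
  classical
  constructor
  · intro hx
    have hle : (⨆ a ∈ Finset.univ.image χ, ⨆ _ : a ≤ c,
      Module.End.eigenspace (Matrix.toLin' (H.G Real.exp)) (Real.exp a)) ≤
      LinearMap.ker (Matrix.toLin' (H.G (fun t => if c < t then 1 else 0))) := by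
      refine iSup₂_le fun a _ => iSup_le fun hac => fun y hy => ?_
      rw [mem_eigenspace_iff'] at hy
      rw [LinearMap.mem_ker, toLin'_apply]
      refine H.kill hy fun j hj => if_neg ?_
      rw [Real.exp_injective hj]; exact not_lt.2 hac
    have := hle hx
    rwa [LinearMap.mem_ker, toLin'_apply] at this
  · intro hx
    have e : (1 : Matrix (Fin d) (Fin d) ℝ) = (∑ a ∈ (Finset.univ.image χ).filter (· ≤ c),
        H.G (fun t => if t = a then 1 else 0)) + H.G (fun t => if c < t then 1 else 0) := by
      rw [H.G_sum, H.G_add, ← H.G_one]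
      refine H.G_congr fun j => ?_
      rw [Finset.sum_ite_eq]
      by_cases hj : χ j ≤ c
      · simp [hj]
      · simp [hj, not_le.1 hj]
    have e2 : x = ∑ a ∈ (Finset.univ.image χ).filter (· ≤ c),
        (H.G (fun t => if t = a then 1 else 0)) *ᵥ x := by
      conv_lhs => rw [← one_mulVec x, e, add_mulVec, hx, add_zero, sum_mulVec]
    rw [e2]
    refine Submodule.sum_mem _ fun a ha => ?_
    rw [Finset.mem_filter] at ha
    have h3 : (H.G (fun t => if t = a then 1 else 0)) *ᵥ x ∈
      Module.End.eigenspace (Matrix.toLin' (H.G Real.exp)) (Real.exp a) :=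
      mem_eigenspace_iff'.2 (H.mem_eig a x)
    exact Submodule.mem_iSup_of_mem a (Submodule.mem_iSup_of_mem ha.1
      (Submodule.mem_iSup_of_mem ha.2 h3))

lemma Os.exists_eig (H : Os U q χ) {c : ℝ} (hc : c ∈ Finset.univ.image χ) :
    ∃ x, H.G (fun t => if t = c then 1 else 0) *ᵥ x ≠ 0 := by
  by_contra h
  push Not at h
  have h0 : H.G (fun t => if t = c then 1 else 0) = 0 := by
    ext i j
    have := congrFun (h (Pi.single j 1)) i
    simpa using this
  have ht := H.G_trace (fun t => if t = c then 1 else 0)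
  rw [h0, trace_zero] at ht
  obtain ⟨i, _, hi⟩ := Finset.mem_image.1 hc
  have := Finset.single_le_sum (f := fun j => if χ j = c then (1:ℝ) else 0) (s := Finset.univ)
    (fun j _ => by positivity) (Finset.mem_univ i)
  simp only [hi, if_true] at this
  linarith

/-- the deterministic conclusions -/
structure Met (ψ : ℕ → Matrix (Fin d) (Fin d) ℝ) (Φ : Matrix (Fin d) (Fin d) ℝ)
    (E : Finset ℝ) : Prop where
  symm : Φ.IsSymm
  pos : Φ.PosDef
  lim : ∃ R : ℕ → Matrix (Fin d) (Fin d) ℝ,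
            (∀ n : ℕ, 1 ≤ n → (R n).IsSymm ∧ (R n).PosDef ∧
              R n ^ (2 * n) = (ψ n)ᵀ * ψ n) ∧ Tendsto R atTop (𝓝 Φ)
  eig : ∀ μ : ℝ, Module.End.eigenspace (Matrix.toLin' Φ) μ ≠ ⊥ ↔ ∃ c ∈ E, μ = Real.exp c
  ly : ∀ x, x ≠ 0 → ∃ l ∈ E,
    Tendsto (fun n : ℕ => (1 / (n : ℝ)) * Real.log (eNorm (ψ n *ᵥ x))) atTop (𝓝 l)
  att : ∀ l ∈ E, ∃ x, x ≠ 0 ∧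
    Tendsto (fun n : ℕ => (1 / (n : ℝ)) * Real.log (eNorm (ψ n *ᵥ x))) atTop (𝓝 l)
  fil : ∀ c x, (x ∈ ⨆ a ∈ E, ⨆ _ : a ≤ c,
      Module.End.eigenspace (Matrix.toLin' Φ) (Real.exp a)) ↔
      (x = 0 ∨ ∃ l ≤ c,
    Tendsto (fun n : ℕ => (1 / (n : ℝ)) * Real.log (eNorm (ψ n *ᵥ x))) atTop (𝓝 l))

lemma posDef_conj {V : Matrix (Fin d) (Fin d) ℝ} (hV : Vᵀ * V = 1) {g : Fin d → ℝ}
    (hg : ∀ i, 0 < g i) : (V * diagonal g * Vᵀ).IsSymm ∧ (V * diagonal g * Vᵀ).PosDef := by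
  have hs : (V * diagonal g * Vᵀ).IsSymm := by
    simp [Matrix.IsSymm, transpose_mul, mul_assoc]
  refine ⟨hs, ?_⟩
  have h1 : (diagonal g).PosDef := PosDef.diagonal hg
  have := h1.mul_mul_conjTranspose_same (B := V) (vecMul_injective_of_isUnit ((isUnit_iff_exists).2 ⟨Vᵀ, mul_eq_one_comm.1 hV, hV⟩))
  rwa [conjTranspose_eq_transpose_of_trivial] at this

lemma orth_conj_pow {V : Matrix (Fin d) (Fin d) ℝ} (hV : Vᵀ * V = 1) (g : Fin d → ℝ) (n : ℕ) :
    (V * diagonal g * Vᵀ) ^ n = V * diagonal (g ^ n) * Vᵀ := by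
  induction n with
  | zero => simp [mul_eq_one_comm.1 hV]
  | succ n ih =>
    rw [pow_succ, ih]
    have : V * diagonal (g ^ n) * Vᵀ * (V * diagonal g * Vᵀ) =
      V * diagonal (g ^ n) * (Vᵀ * V) * diagonal g * Vᵀ := by simp only [mul_assoc]
    rw [this, hV, mul_one, mul_assoc V (diagonal _) (diagonal _), diagonal_mul_diagonal]
    rfl

lemma yq_eq {ψ : ℕ → Matrix (Fin d) (Fin d) ℝ} {n : ℕ}
    (hψ : (ψ n)ᵀ * ψ n = U n * diagonal (q n) * (U n)ᵀ) (x : Fin d → ℝ) :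
    eNorm (ψ n *ᵥ x) ^ 2 = yq U q n x := by
  rw [eNorm_sq_dot, dotProduct_mulVec, vecMul_mulVec, hψ, ← vecMul_vecMul, ← dotProduct_mulVec,
    ← vecMul_vecMul, ← mulVec_transpose (U n) x]
  simp only [yq, dotProduct, vecMul_diagonal]
  exact Finset.sum_congr rfl fun k _ => by ring

theorem Os.met (H : Os U q χ) {ψ : ℕ → Matrix (Fin d) (Fin d) ℝ}
    (hψ : ∀ n, (ψ n)ᵀ * ψ n = U n * diagonal (q n) * (U n)ᵀ) :
    ∃ Φ E, Met ψ Φ E := by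
  have hfun : ∀ x, (fun n : ℕ => (1 / (n : ℝ)) * Real.log (eNorm (ψ n *ᵥ x))) =
      fun n : ℕ => Real.log (yq U q n x) / (2 * n) := by
    intro x
    ext n
    rw [← yq_eq (hψ n), Real.log_pow]
    push_cast
    by_cases hn : (n:ℝ) = 0
    · simp [hn]
    · field_simp
  have hΦpos : (H.G Real.exp).PosDef := by
    have e : H.G Real.exp = (H.G (fun t => Real.exp (t/2)))ᴴ * (H.G (fun t => Real.exp (t/2))) := by
      rw [conjTranspose_eq_transpose_of_trivial, H.G_symm, H.G_mul]
      refine H.G_congr fun j => ?_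
      rw [← Real.exp_add]; congr 1; ring
    have e2 : H.G (fun t => Real.exp (-(t/2))) * H.G (fun t => Real.exp (t/2)) = 1 := by
      rw [H.G_mul, ← H.G_one]
      refine H.G_congr fun j => ?_
      rw [← Real.exp_add]; simp
    rw [e]
    exact PosDef.conjTranspose_mul_self _ (mulVec_injective_of_isUnit
      ((isUnit_iff_exists).2 ⟨_, mul_eq_one_comm.1 e2, e2⟩))
  refine ⟨H.G Real.exp, Finset.univ.image χ, H.G_symm _, hΦpos, ?_, ?_, ?_, ?_, ?_⟩
  · refine ⟨fun n => U n * diagonal (fun k => Real.exp (Real.log (q n k) / (2 * n))) * (U n)ᵀ,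
      fun n hn => ?_, ?_⟩
    · have := posDef_conj (H.hU n) (g := fun k => Real.exp (Real.log (q n k) / (2 * n)))
        (fun _ => Real.exp_pos _)
      refine ⟨this.1, this.2, ?_⟩
      rw [orth_conj_pow (H.hU n), hψ]
      congr 3
      ext k
      simp only [Pi.pow_apply]
      rw [← Real.exp_nat_mul]
      have hn0 : (0:ℝ) < n := by exact_mod_cast hn
      push_cast
      rw [mul_div_cancel₀ _ (by positivity), Real.exp_log (H.hq0 n k)]
    · have h0 : Tendsto (fun n : ℕ => U n * diagonal (fun k => Real.exp (Real.log (q n k) / (2 * n)) - Real.exp (χ k)) * (U n)ᵀ) atTop (𝓝 0) := by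
        refine tendsto_pi_nhds.2 fun i => tendsto_pi_nhds.2 fun j => ?_
        have hz : Tendsto (fun n : ℕ => ∑ k, |Real.exp (Real.log (q n k) / (2 * n)) - Real.exp (χ k)|) atTop (𝓝 (∑ k : Fin d, 0)) := by
          refine tendsto_finsetSum _ fun k _ => ?_
          have := ((Real.continuous_exp.tendsto _).comp (H.hq k)).sub_const (Real.exp (χ k))
          rw [sub_self] at this
          simpa using this.abs
        rw [Finset.sum_const_zero] at hz
        refine squeeze_zero_norm (fun n => ?_) hz
        rw [Real.norm_eq_abs, Matrix.mul_apply]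
        refine (Finset.abs_sum_le_sum_abs _ _).trans (Finset.sum_le_sum fun k _ => ?_)
        rw [mul_diagonal, transpose_apply, abs_mul, abs_mul]
        have b1 := orth_entry (H.hU n) i k
        have b2 := orth_entry (H.hU n) j k
        have : |U n i k| * |U n j k| ≤ 1 := mul_le_one₀ b1 (abs_nonneg _) b2
        nlinarith [abs_nonneg (Real.exp (Real.log (q n k) / (2 * n)) - Real.exp (χ k))]
      have := h0.add (H.G_spec Real.exp)
      rw [zero_add] at this
      refine this.congr fun n => ?_
      unfold Gn
      rw [← add_mul, ← mul_add, diagonal_add]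
      simp
  · intro μ
    constructor
    · intro hμ
      obtain ⟨x, hx, hx0⟩ := Submodule.exists_mem_ne_zero_of_ne_bot hμ
      rw [mem_eigenspace_iff'] at hx
      by_contra hcon
      push Not at hcon
      apply hx0
      have := H.kill hx (k := fun _ => 1) (fun j hj => absurd hj.symm (hcon (χ j) (by simp)))
      rwa [H.G_one, one_mulVec] at this
    · rintro ⟨c, hc, rfl⟩ hbot
      obtain ⟨x, hx⟩ := H.exists_eig hc
      have := mem_eigenspace_iff'.2 (H.mem_eig c x)
      rw [hbot, Submodule.mem_bot] at this
      exact hx this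
  · intro x hx
    obtain ⟨l, hl, h1, h2⟩ := H.exists_ly hx
    refine ⟨l, hl, ?_⟩
    rw [hfun]; exact H.ly_of h1 h2
  · intro c hc
    obtain ⟨y, hy⟩ := H.exists_eig hc
    refine ⟨_, hy, ?_⟩
    rw [hfun]
    refine H.ly_of ?_ ?_
    · rw [mulVec_mulVec, H.G_mul, H.G_congr (k := fun t => if t = c then 1 else 0)]
      · exact hy
      · intro j; by_cases h : χ j = c <;> simp [h]
    · rw [mulVec_mulVec, H.G_mul, H.G_congr (k := fun t => 0), H.G_zero, zero_mulVec]
      intro j; by_cases h : χ j = c <;> simp [h]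
  · intro c x
    rw [H.filt, hfun]
    by_cases hx : x = 0
    · simp [hx]
    obtain ⟨l, hl, h1, h2⟩ := H.exists_ly hx
    have h3 := H.ly_of h1 h2
    simp only [hx, false_or]
    constructor
    · intro h
      refine ⟨l, ?_, h3⟩
      by_contra hlc
      push Not at hlc
      apply h1
      have : H.G (fun t => if l ≤ t then 1 else 0) = H.G (fun t => if l ≤ t then 1 else 0) *
          H.G (fun t => if c < t then 1 else 0) := by
        rw [H.G_mul]
        refine H.G_congr fun j => ?_
        by_cases hj : l ≤ χ j
        · simp [hj, hlc.trans_le hj]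
        · simp [hj]
      rw [this, ← mulVec_mulVec, h, mulVec_zero]
    · rintro ⟨l', hl', ht⟩
      have := tendsto_nhds_unique ht h3
      subst this
      have : H.G (fun t => if c < t then 1 else 0) = H.G (fun t => if c < t then 1 else 0) *
          H.G (fun t => if l' < t then 1 else 0) := by
        rw [H.G_mul]
        refine H.G_congr fun j => ?_
        by_cases hj : c < χ j
        · simp [hj, hl'.trans_lt hj]
        · simp [hj]
      rw [this, ← mulVec_mulVec, h2, mulVec_zero]

end os3



section svdsel
variable {d : ℕ}

lemma exists_svd (M : GL (Fin d) ℝ) : ∃ (U : Matrix (Fin d) (Fin d) ℝ) (q : Fin d → ℝ),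
    Uᵀ * U = 1 ∧ (∀ i, 0 < q i) ∧ Antitone q ∧
    (M : Matrix (Fin d) (Fin d) ℝ)ᵀ * (M : Matrix (Fin d) (Fin d) ℝ) = U * diagonal q * Uᵀ := by
  have hpd : ((M : Matrix (Fin d) (Fin d) ℝ)ᵀ * (M : Matrix (Fin d) (Fin d) ℝ)).PosDef := by
    have := PosDef.conjTranspose_mul_self (M : Matrix (Fin d) (Fin d) ℝ)
      (mulVec_injective_of_isUnit M.isUnit)
    rwa [conjTranspose_eq_transpose_of_trivial] at this
  set S := (M : Matrix (Fin d) (Fin d) ℝ)ᵀ * (M : Matrix (Fin d) (Fin d) ℝ) with hS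
  have hH := hpd.isHermitian
  have hsp := hH.spectral_theorem
  rw [Unitary.conjStarAlgAut_apply] at hsp
  set V : Matrix (Fin d) (Fin d) ℝ := (hH.eigenvectorUnitary : Matrix (Fin d) (Fin d) ℝ) with hV
  have hVV : Vᵀ * V = 1 := by
    have := Unitary.coe_star_mul_self hH.eigenvectorUnitary
    rw [Matrix.star_eq_conjTranspose, conjTranspose_eq_transpose_of_trivial] at this
    exact this
  rw [Matrix.star_eq_conjTranspose, conjTranspose_eq_transpose_of_trivial] at hsp
  set σ : Equiv.Perm (Fin d) := Fin.revPerm.trans (Tuple.sort hH.eigenvalues) with hσ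
  refine ⟨V.submatrix id σ, hH.eigenvalues ∘ σ, ?_, fun i => hpd.eigenvalues_pos _, ?_, ?_⟩
  · have h := submatrix_mul_equiv Vᵀ V σ (Equiv.refl _) σ
    rw [hVV, submatrix_one_equiv] at h
    exact h
  · intro i j hij
    exact Tuple.monotone_sort hH.eigenvalues (Fin.rev_le_rev.2 hij)
  · have : diagonal (hH.eigenvalues ∘ σ) = (diagonal hH.eigenvalues).submatrix σ σ := by
      simp
    rw [this, transpose_submatrix, submatrix_mul_equiv, submatrix_mul_equiv]
    simpa using hsp

lemma cmp2_one_eq (M : Matrix (Fin d) (Fin d) ℝ) : cmp2 1 M = ∑ i, ∑ j, M i j ^ 2 := by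
  unfold cmp2
  refine Fintype.sum_equiv (Equiv.funUnique (Fin 1) (Fin d)) _ _ fun r => ?_
  refine Fintype.sum_equiv (Equiv.funUnique (Fin 1) (Fin d)) _ _ fun c => ?_
  simp

lemma eNorm_sq_mulVec_le (M : Matrix (Fin d) (Fin d) ℝ) (x : Fin d → ℝ) :
    eNorm (M *ᵥ x) ^ 2 ≤ (∑ i, ∑ j, M i j ^ 2) * eNorm x ^ 2 := by
  rw [eNorm_sq, eNorm_sq, Finset.sum_mul]
  exact Finset.sum_le_sum fun i _ => Finset.sum_mul_sq_le_sq_mul_sq Finset.univ (fun j => M i j) x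

lemma eNorm_sq_le_exp (hd : 1 ≤ d) (M : GL (Fin d) ℝ) {γ : ℝ}
    (h : lcmp 1 (M : Matrix (Fin d) (Fin d) ℝ) ≤ γ) (x : Fin d → ℝ) :
    eNorm ((M : Matrix (Fin d) (Fin d) ℝ) *ᵥ x) ^ 2 ≤ Real.exp γ * eNorm x ^ 2 := by
  refine (eNorm_sq_mulVec_le _ x).trans (mul_le_mul_of_nonneg_right ?_ (sq_nonneg _))
  rw [← cmp2_one_eq, ← Real.exp_log (cmp2_pos hd M)]
  refine Real.exp_le_exp.2 ?_
  simpa [lcmp] using h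

theorem met_of (hd : 1 ≤ d) {ψ B : ℕ → GL (Fin d) ℝ} (hB : ∀ n, ψ (n+1) = B n * ψ n)
    {γ : ℕ → ℝ} (hγ1 : ∀ n, lcmp 1 (B n : Matrix (Fin d) (Fin d) ℝ) ≤ γ n)
    (hγ2 : ∀ n, lcmp 1 (((B n)⁻¹ : GL (Fin d) ℝ) : Matrix (Fin d) (Fin d) ℝ) ≤ γ n)
    (hγ : Tendsto (fun n : ℕ => γ n / n) atTop (𝓝 0))
    (hl : ∀ k ≤ d, ∃ l, Tendsto (fun n : ℕ => lcmp k (ψ n : Matrix (Fin d) (Fin d) ℝ) / n)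
      atTop (𝓝 l)) :
    ∃ Φ E, Met (fun n => (ψ n : Matrix (Fin d) (Fin d) ℝ)) Φ E := by
  choose U q hU hq0 hqa hψ using fun n => exists_svd (ψ n)
  have hs : ∀ k (hk : k ≤ d), ∃ l, Tendsto (fun n : ℕ =>
      (∑ i : Fin k, Real.log (q n (Fin.castLE hk i))) / n) atTop (𝓝 l) := by
    intro k hk
    obtain ⟨l, hl⟩ := hl k hk
    refine ⟨l, ?_⟩
    have hz : Tendsto (fun n : ℕ => (lcmp k (ψ n : Matrix (Fin d) (Fin d) ℝ) -
        ∑ i : Fin k, Real.log (q n (Fin.castLE hk i))) / n) atTop (𝓝 0) := by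
      refine squeeze_zero_norm (fun n => ?_)
        (tendsto_const_div_atTop_nhds_zero_nat (Real.log k.factorial + k * Real.log d))
      rw [norm_div, Real.norm_eq_abs, Real.norm_eq_abs, Nat.abs_cast]
      exact div_le_div_of_nonneg_right (lcmp_svd hk (ψ n) (hU n) (hq0 n) (hqa n) (hψ n))
        (Nat.cast_nonneg n)
    have := hl.sub hz
    rw [sub_zero] at this
    refine this.congr fun n => ?_
    rw [← sub_div]; congr 1; ring
  have hχ : ∀ i : Fin d, ∃ c, Tendsto (fun n : ℕ => Real.log (q n i) / (2 * n)) atTop (𝓝 c) := by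
    intro i
    obtain ⟨l1, h1⟩ := hs i.1 i.2.le
    obtain ⟨l2, h2⟩ := hs (i.1+1) i.2
    refine ⟨(l2 - l1)/2, ((h2.sub h1).div_const 2).congr fun n => ?_⟩
    rw [Fin.sum_univ_castSucc, ← sub_div, div_div, mul_comm (n:ℝ)]
    congr 1
    have e1 : Fin.castLE i.2 (Fin.last i.1) = i := rfl
    rw [e1]
    have e2 : ∑ j : Fin i.1, Real.log (q n (Fin.castLE i.2 j.castSucc)) =
      ∑ j : Fin i.1, Real.log (q n (Fin.castLE i.2.le j)) := rfl
    rw [e2]; ring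
  choose χ hχ using hχ
  have hU' : ∀ n, U n * (U n)ᵀ = 1 := fun n => mul_eq_one_comm.1 (hU n)
  have hy : ∀ n x, eNorm ((ψ n : Matrix (Fin d) (Fin d) ℝ) *ᵥ x) ^ 2 = yq U q n x := fun n x =>
    yq_eq (ψ := fun n => (ψ n : Matrix (Fin d) (Fin d) ℝ)) (hψ n) x
  have hself : ∀ n l, yq U q n (U n *ᵥ Pi.single l 1) = q n l := by
    intro n l
    unfold yq
    rw [mulVec_mulVec, hU, one_mulVec, Finset.sum_eq_single l]
    · simp
    · intro b _ hb; simp [Pi.single_eq_of_ne hb]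
    · simp
  have hge : ∀ n k x, q n k * (((U n)ᵀ *ᵥ x) k)^2 ≤ yq U q n x := by
    intro n k x
    exact Finset.single_le_sum (f := fun k => q n k * (((U n)ᵀ *ᵥ x) k)^2)
      (fun k _ => mul_nonneg (hq0 n k).le (sq_nonneg _)) (Finset.mem_univ k)
  have H : Os U q χ := by
    refine Os.mk' hU hq0 hχ (a := fun n => Real.exp (γ n)) (fun n => Real.exp_pos _)
      (by simpa using hγ) ?_ ?_
    · intro n k l
      have e : (((U n)ᵀ * U (n+1)) k l) = ((U n)ᵀ *ᵥ (U (n+1) *ᵥ Pi.single l 1)) k := by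
        rw [mulVec_mulVec]; simp
      rw [e]
      refine (hge n k _).trans ?_
      rw [← hy, ← hself (n+1) l, ← hy]
      have e3 : (ψ n : Matrix (Fin d) (Fin d) ℝ) = (((B n)⁻¹ : GL (Fin d) ℝ) : Matrix (Fin d) (Fin d) ℝ) *
          (ψ (n+1) : Matrix (Fin d) (Fin d) ℝ) := by
        rw [← Units.val_mul, hB, inv_mul_cancel_left]
      rw [e3, ← mulVec_mulVec]
      exact eNorm_sq_le_exp hd _ (hγ2 n) _
    · intro n k l
      have e : (((U n)ᵀ * U (n+1)) k l) = ((U (n+1))ᵀ *ᵥ (U n *ᵥ Pi.single k 1)) l := by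
        rw [mulVec_mulVec]; simp [mul_apply, mul_comm]
      rw [e]
      refine (hge (n+1) l _).trans ?_
      rw [← hy, ← hself n k, ← hy]
      rw [hB, Units.val_mul, ← mulVec_mulVec]
      exact eNorm_sq_le_exp hd _ (hγ1 n) _
  exact H.met hψ

end svdsel



section fin1
variable {d : ℕ}

lemma opNorm_bdd (M : Matrix (Fin d) (Fin d) ℝ) :
    BddAbove (Set.range fun x : {x : Fin d → ℝ // eNorm x ≤ 1} => eNorm (M *ᵥ (x : Fin d → ℝ))) := by
  refine ⟨Real.sqrt (∑ i, ∑ j, M i j ^ 2), ?_⟩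
  rintro _ ⟨⟨x, hx⟩, rfl⟩
  refine Real.le_sqrt_of_sq_le ((eNorm_sq_mulVec_le M x).trans ?_)
  refine mul_le_of_le_one_right (by positivity) ?_
  exact pow_le_one₀ (eNorm_nonneg' x) hx

lemma entry_le_opNorm (M : Matrix (Fin d) (Fin d) ℝ) (i j : Fin d) : |M i j| ≤ opNorm M := by
  have h1 : eNorm (Pi.single j (1:ℝ) : Fin d → ℝ) ≤ 1 := by
    unfold eNorm
    rw [Finset.sum_eq_single j]
    · simp
    · intro b _ hb; simp [Pi.single_eq_of_ne hb]
    · simp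
  have h2 := le_ciSup (opNorm_bdd M) ⟨Pi.single j 1, h1⟩
  refine le_trans ?_ h2
  have := abs_le_eNorm (M *ᵥ (Pi.single j (1:ℝ))) i
  simpa using this

lemma lcmp_le_opNorm {k : ℕ} (hk : k ≤ d) (M : GL (Fin d) ℝ) :
    lcmp k (M : Matrix (Fin d) (Fin d) ℝ) ≤ Real.log (d ^ k * d ^ k) +
      2 * k * max (Real.log (opNorm (M : Matrix (Fin d) (Fin d) ℝ))) 0 := by
  have h0 : 0 ≤ opNorm (M : Matrix (Fin d) (Fin d) ℝ) :=
    Real.iSup_nonneg fun x => eNorm_nonneg' _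
  refine (lcmp_le_of_entries hk M (b := max (opNorm (M : Matrix (Fin d) (Fin d) ℝ)) 1)
    (fun i j => (entry_le_opNorm _ i j).trans (le_max_left _ _)) (le_max_right _ _)).trans
    (le_of_eq ?_)
  congr 2
  rcases le_total (opNorm (M : Matrix (Fin d) (Fin d) ℝ)) 1 with h | h
  · rw [max_eq_right h, Real.log_one, max_eq_right (Real.log_nonpos h0 h)]
  · rw [max_eq_left h, max_eq_left (Real.log_nonneg h)]

lemma abs_lcmp_le {k : ℕ} (hk : k ≤ d) (M : GL (Fin d) ℝ) :
    |lcmp k (M : Matrix (Fin d) (Fin d) ℝ)| +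
      |lcmp k ((M⁻¹ : GL (Fin d) ℝ) : Matrix (Fin d) (Fin d) ℝ)| ≤
      2 * (|Real.log (d ^ k * d ^ k)| +
      2 * k * max (Real.log (opNorm (M : Matrix (Fin d) (Fin d) ℝ))) 0 +
      2 * k * max (Real.log (opNorm ((M⁻¹ : GL (Fin d) ℝ) : Matrix (Fin d) (Fin d) ℝ))) 0) := by
  have h1 := lcmp_le_opNorm hk M
  have h2 := lcmp_le_opNorm hk M⁻¹
  have h3 := lcmp_inv hk M
  have h4 := le_abs_self (Real.log ((d:ℝ) ^ k * d ^ k))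
  have p1 : 0 ≤ 2 * k * max (Real.log (opNorm (M : Matrix (Fin d) (Fin d) ℝ))) 0 := by positivity
  have p2 : 0 ≤ 2 * k * max (Real.log (opNorm ((M⁻¹ : GL (Fin d) ℝ) : Matrix (Fin d) (Fin d) ℝ))) 0 := by
    positivity
  have a1 : |lcmp k (M : Matrix (Fin d) (Fin d) ℝ)| ≤ (|Real.log (d ^ k * d ^ k)| +
      2 * k * max (Real.log (opNorm (M : Matrix (Fin d) (Fin d) ℝ))) 0 +
      2 * k * max (Real.log (opNorm ((M⁻¹ : GL (Fin d) ℝ) : Matrix (Fin d) (Fin d) ℝ))) 0) :=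
    abs_le.2 ⟨by linarith, by linarith⟩
  have a2 : |lcmp k ((M⁻¹ : GL (Fin d) ℝ) : Matrix (Fin d) (Fin d) ℝ)| ≤ (|Real.log (d ^ k * d ^ k)| +
      2 * k * max (Real.log (opNorm (M : Matrix (Fin d) (Fin d) ℝ))) 0 +
      2 * k * max (Real.log (opNorm ((M⁻¹ : GL (Fin d) ℝ) : Matrix (Fin d) (Fin d) ℝ))) 0) :=
    abs_le.2 ⟨by linarith, by linarith⟩
  linarith

lemma coc_succ {Ω : Type*} (θ : Equiv.Perm Ω) (A : Ω → GL (Fin d) ℝ)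
    (φ : ℤ → Ω → GL (Fin d) ℝ)
    (hφ1 : ∀ ω, φ 1 ω = A ω)
    (hφc : ∀ (m n : ℤ) (ω : Ω), φ (m + n) ω = φ m ((θ ^ n) ω) * φ n ω) (n : ℕ) (ω : Ω) :
    φ ((n + 1 : ℕ) : ℤ) ω = A (θ^[n] ω) * φ (n : ℤ) ω := by
  have : ((n + 1 : ℕ) : ℤ) = 1 + (n : ℤ) := by push_cast; ring
  rw [this, hφc, hφ1, zpow_natCast, Equiv.Perm.iterate_eq_pow]

theorem ae_met (hd : 1 ≤ d)
    {Ω : Type*} [MeasurableSpace Ω] (ℙ : Measure Ω) [IsProbabilityMeasure ℙ]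
    (θ : Equiv.Perm Ω) 
    (hθpres : MeasurePreserving (θ : Ω → Ω) ℙ ℙ)
    (A : Ω → GL (Fin d) ℝ)
    (hA : ∀ i j, Measurable fun ω => (A ω : Matrix (Fin d) (Fin d) ℝ) i j)
    (φ : ℤ → Ω → GL (Fin d) ℝ)
    (hφ0 : ∀ ω, φ 0 ω = 1)
    (hφ1 : ∀ ω, φ 1 ω = A ω)
    (hφc : ∀ (m n : ℤ) (ω : Ω), φ (m + n) ω = φ m ((θ ^ n) ω) * φ n ω)
    (hint₁ : Integrable
      (fun ω => max (Real.log (opNorm (A ω : Matrix (Fin d) (Fin d) ℝ))) 0) ℙ)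
    (hint₂ : Integrable
      (fun ω => max (Real.log (opNorm (((A ω)⁻¹ : GL (Fin d) ℝ) : Matrix (Fin d) (Fin d) ℝ))) 0)
      ℙ) :
    ∀ᵐ ω ∂ℙ, ∃ Φ E, Met (fun n : ℕ => (φ (n : ℤ) ω : Matrix (Fin d) (Fin d) ℝ)) Φ E := by
  have hs := coc_succ θ A φ hφ1 hφc
  have hmeas : ∀ n : ℕ, ∀ i j, Measurable fun ω => (φ (n:ℤ) ω : Matrix (Fin d) (Fin d) ℝ) i j := by
    intro n
    induction n with
    | zero => intro i j; simp only [Nat.cast_zero, hφ0]; exact measurable_const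
    | succ n ih =>
      intro i j
      simp only [hs, Units.val_mul, Matrix.mul_apply]
      exact Finset.measurable_sum _ fun k _ =>
        ((hA i k).comp (hθpres.measurable.iterate n)).mul (ih k j)
  set g : ℕ → Ω → ℝ := fun k ω => |lcmp k (A ω : Matrix (Fin d) (Fin d) ℝ)| +
      |lcmp k (((A ω)⁻¹ : GL (Fin d) ℝ) : Matrix (Fin d) (Fin d) ℝ)| with hg
  have hgm : ∀ k, Measurable (g k) := fun k =>
    (measurable_cmp hA).abs.add (measurable_cmp (measurable_inv_entries hA)).abs
  have hg0 : ∀ k ω, 0 ≤ g k ω := fun k ω => by simp only [hg]; positivity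
  have hgi : ∀ k ≤ d, Integrable (g k) ℙ := by
    intro k hk
    refine Integrable.mono' (g := fun ω => 2 * (|Real.log (d ^ k * d ^ k)| +
      2 * k * max (Real.log (opNorm (A ω : Matrix (Fin d) (Fin d) ℝ))) 0 +
      2 * k * max (Real.log (opNorm (((A ω)⁻¹ : GL (Fin d) ℝ) : Matrix (Fin d) (Fin d) ℝ))) 0))
      ((((integrable_const _).add (hint₁.const_mul (2 * k))).add (hint₂.const_mul (2*k))).const_mul 2)
      (hgm k).aestronglyMeasurable (Eventually.of_forall fun ω => ?_)
    rw [Real.norm_eq_abs, abs_of_nonneg (hg0 k ω)]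
    exact abs_lcmp_le hk (A ω)
  have hK : ∀ k ≤ d, ∀ᵐ ω ∂ℙ, ∃ l, Tendsto (fun n : ℕ =>
      lcmp k (φ (n:ℤ) ω : Matrix (Fin d) (Fin d) ℝ) / n) atTop (𝓝 l) := by
    intro k hk
    refine kingman hθpres (f := fun n ω => lcmp k (φ (n:ℤ) ω : Matrix (Fin d) (Fin d) ℝ))
      (fun n => measurable_cmp (hmeas n)) ?_ (hgm k) (hgi k hk) (hg0 k) ?_ ?_
    · intro m n ω
      have : ((m + n : ℕ) : ℤ) = (n:ℤ) + (m:ℤ) := by push_cast; ring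
      simp only [this, hφc, zpow_natCast, Equiv.Perm.iterate_eq_pow]
      rw [add_comm]
      exact lcmp_mul hk _ _
    · intro n ω
      induction n with
      | zero =>
        simp only [hs, Function.iterate_zero, id, birkhoffSum_one, zero_add, Nat.cast_zero, hφ0, mul_one]
        exact (le_abs_self _).trans (le_add_of_nonneg_right (abs_nonneg _))
      | succ n ih =>
        rw [birkhoffSum_succ]
        simp only [hs (n+1)]
        refine (lcmp_mul hk _ _).trans ?_
        rw [add_comm]
        refine add_le_add ih ?_
        exact (le_abs_self _).trans (le_add_of_nonneg_right (abs_nonneg _))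
    · intro n ω
      induction n with
      | zero =>
        simp only [hs, Function.iterate_zero, id, birkhoffSum_one, zero_add, Nat.cast_zero, hφ0, mul_one]
        have := neg_abs_le (lcmp k (A ω : Matrix (Fin d) (Fin d) ℝ))
        have h2 := abs_nonneg (lcmp k (((A ω)⁻¹ : GL (Fin d) ℝ) : Matrix (Fin d) (Fin d) ℝ))
        simp only [hg]
        linarith
      | succ n ih =>
        rw [birkhoffSum_succ]
        have e : φ ((n+1 : ℕ):ℤ) ω = (A (θ^[n+1] ω))⁻¹ * φ ((n+1+1 : ℕ):ℤ) ω := by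
          rw [hs (n+1), inv_mul_cancel_left]
        have h1 := lcmp_mul hk (A (θ^[n+1] ω))⁻¹ (φ ((n+1+1 : ℕ):ℤ) ω)
        rw [← e] at h1
        have h2 := le_abs_self (lcmp k (((A (θ^[n+1] ω))⁻¹ : GL (Fin d) ℝ) : Matrix (Fin d) (Fin d) ℝ))
        have h3 := abs_nonneg (lcmp k (A (θ^[n+1] ω) : Matrix (Fin d) (Fin d) ℝ))
        have h4 : g k (θ^[n+1] ω) = |lcmp k (A (θ^[n+1] ω) : Matrix (Fin d) (Fin d) ℝ)| +
          |lcmp k (((A (θ^[n+1] ω))⁻¹ : GL (Fin d) ℝ) : Matrix (Fin d) (Fin d) ℝ)| := rfl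
        linarith
  have hK' : ∀ᵐ ω ∂ℙ, ∀ k, k ≤ d → ∃ l, Tendsto (fun n : ℕ =>
      lcmp k (φ (n:ℤ) ω : Matrix (Fin d) (Fin d) ℝ) / n) atTop (𝓝 l) :=
    ae_all_iff.2 fun k => by
      by_cases hk : k ≤ d
      · filter_upwards [hK k hk] with ω hω _
        exact hω
      · exact Eventually.of_forall fun ω h => absurd h hk
  filter_upwards [hK', birkhoff_term hθpres (hgm 1) (hgi 1 hd) (hg0 1)] with ω h1 h2
  exact met_of hd (ψ := fun n => φ (n:ℤ) ω) (B := fun n => A (θ^[n] ω)) (fun n => hs n ω)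
    (γ := fun n => g 1 (θ^[n] ω))
    (fun n => (le_abs_self _).trans (le_add_of_nonneg_right (abs_nonneg _)))
    (fun n => (le_abs_self _).trans (le_add_of_nonneg_left (abs_nonneg _))) h2 h1

lemma tendsto_shift (u : ℕ → ℝ) (l : ℝ) :
    Tendsto (fun n : ℕ => (1 / (n:ℝ)) * u (n+1)) atTop (𝓝 l) ↔
      Tendsto (fun n : ℕ => (1 / (n:ℝ)) * u n) atTop (𝓝 l) := by
  rw [← tendsto_add_atTop_iff_nat (f := fun n : ℕ => (1 / (n:ℝ)) * u n) 1]
  have t := tendsto_succ_div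
  have t' := t.inv₀ one_ne_zero
  constructor
  · intro h
    have := h.mul t'
    rw [inv_one, mul_one] at this
    refine this.congr' ?_
    filter_upwards [eventually_ge_atTop 1] with n hn
    have : (0:ℝ) < n := by exact_mod_cast hn
    push_cast
    field_simp
  · intro h
    have := h.mul t
    rw [mul_one] at this
    refine this.congr' ?_
    filter_upwards [eventually_ge_atTop 1] with n hn
    have : (0:ℝ) < n := by exact_mod_cast hn
    push_cast
    field_simp

def lamE (E : Finset ℝ) (i : Fin E.card) : ℝ := E.orderEmbOfFin rfl i.rev

lemma lamE_anti (E : Finset ℝ) : StrictAnti (lamE E) := fun _ _ h =>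
  (E.orderEmbOfFin rfl).strictMono (Fin.rev_lt_rev.2 h)

lemma lamE_mem (E : Finset ℝ) (i : Fin E.card) : lamE E i ∈ E := Finset.orderEmbOfFin_mem _ _ _

lemma lamE_surj (E : Finset ℝ) {a : ℝ} (ha : a ∈ E) : ∃ i, lamE E i = a := by
  have : a ∈ Set.range (E.orderEmbOfFin rfl) := by rw [Finset.range_orderEmbOfFin]; exact ha
  obtain ⟨j, hj⟩ := this
  exact ⟨j.rev, by rw [lamE, Fin.rev_rev]; exact hj⟩

lemma lamE_cast {E E' : Finset ℝ} (h : E' = E) (hc : E.card = E'.card) (i : Fin E.card) :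
    lamE E' (Fin.cast hc i) = lamE E i := by
  subst h; rfl

lemma lamE_sup (E : Finset ℝ) (f : ℝ → Submodule ℝ (Fin d → ℝ)) (i : Fin E.card) :
    (⨆ j : Fin E.card, ⨆ _ : i ≤ j, f (lamE E j)) = ⨆ a ∈ E, ⨆ _ : a ≤ lamE E i, f a := by
  apply le_antisymm
  · refine iSup₂_le fun j hij => ?_
    exact le_iSup_of_le (lamE E j) (le_iSup_of_le (lamE_mem E j)
      (le_iSup_of_le ((lamE_anti E).le_iff_ge.2 hij) le_rfl))
  · refine iSup₂_le fun a ha => iSup_le fun hle => ?_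
    obtain ⟨j, rfl⟩ := lamE_surj E ha
    exact le_iSup₂_of_le j ((lamE_anti E).le_iff_ge.1 hle) le_rfl

end fin1

/-- MET for a discrete-time linear cocycle, part (iv): on a `θ`-invariant full-measure set
`Ω̃`, the limit `Φ(ω) = lim_{n→∞} (φ(n,ω)ᵀφ(n,ω))^{1/(2n)}` exists (with distinct eigenvalues
`e^{lam ω 0} > ⋯ > e^{lam ω (p ω - 1)}`); the Lyapunov exponent is invariant,
`λ(θω, A(ω)x) = λ(ω,x)` for all `x ≠ 0`, and consequently `A(ω) V_i(ω) = V_i(θω)` for each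
`i`, where `V_i(ω) = U_{p}(ω) ⊕ ⋯ ⊕ U_i(ω)` and `U_j(ω)` is the eigenspace of `Φ(ω)` for its
`j`-th largest distinct eigenvalue. -/
theorem discrete_MET_invariance
    {d : ℕ} (hd : 1 ≤ d)
    {Ω : Type*} [MeasurableSpace Ω] (ℙ : Measure Ω) [IsProbabilityMeasure ℙ]
    (θ : Equiv.Perm Ω) (hθmeas : Measurable (θ : Ω → Ω))
    (hθinv : Measurable (θ.symm : Ω → Ω))
    (hθpres : MeasurePreserving (θ : Ω → Ω) ℙ ℙ)
    (A : Ω → GL (Fin d) ℝ)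
    (hA : ∀ i j, Measurable fun ω => (A ω : Matrix (Fin d) (Fin d) ℝ) i j)
    (φ : ℤ → Ω → GL (Fin d) ℝ)
    (hφ0 : ∀ ω, φ 0 ω = 1)
    (hφ1 : ∀ ω, φ 1 ω = A ω)
    (hφc : ∀ (m n : ℤ) (ω : Ω), φ (m + n) ω = φ m ((θ ^ n) ω) * φ n ω)
    (hint₁ : Integrable
      (fun ω => max (Real.log (opNorm (A ω : Matrix (Fin d) (Fin d) ℝ))) 0) ℙ)
    (hint₂ : Integrable
      (fun ω => max (Real.log (opNorm (((A ω)⁻¹ : GL (Fin d) ℝ) : Matrix (Fin d) (Fin d) ℝ))) 0)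
      ℙ) :
    ∃ (Ω' : Set Ω) (Φ : Ω → Matrix (Fin d) (Fin d) ℝ) (p : Ω → ℕ)
      (lam : ∀ ω : Ω, Fin (p ω) → ℝ),
      MeasurableSet Ω' ∧ ℙ Ω' = 1 ∧ (θ : Ω → Ω) ⁻¹' Ω' = Ω' ∧
      ∀ ω ∈ Ω',
        -- existence of the limit `Φ(ω)`
        ((Φ ω).IsSymm ∧ (Φ ω).PosDef ∧
          ∃ R : ℕ → Matrix (Fin d) (Fin d) ℝ,
            (∀ n : ℕ, 1 ≤ n → (R n).IsSymm ∧ (R n).PosDef ∧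
              R n ^ (2 * n) =
                ((φ (n : ℤ) ω : Matrix (Fin d) (Fin d) ℝ))ᵀ *
                  ((φ (n : ℤ) ω : Matrix (Fin d) (Fin d) ℝ))) ∧
            Tendsto R atTop (𝓝 (Φ ω))) ∧
        -- `e^{lam ω 0} > ⋯ > e^{lam ω (p ω -1)}` are the distinct eigenvalues of `Φ(ω)`
        StrictAnti (lam ω) ∧
        (∀ μ : ℝ,
          Module.End.eigenspace (Matrix.toLin' (Φ ω)) μ ≠ ⊥ ↔
            ∃ i : Fin (p ω), μ = Real.exp (lam ω i)) ∧
        -- invariance of the Lyapunov exponent: `λ(θω, A(ω)x) = λ(ω, x)`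
        (∀ x : Fin d → ℝ, x ≠ 0 →
          ∃ l : ℝ,
            Tendsto
              (fun n : ℕ =>
                (1 / (n : ℝ)) *
                  Real.log (eNorm ((φ (n : ℤ) ω : Matrix (Fin d) (Fin d) ℝ) *ᵥ x)))
              atTop (𝓝 l) ∧
            Tendsto
              (fun n : ℕ =>
                (1 / (n : ℝ)) *
                  Real.log (eNorm ((φ (n : ℤ) (θ ω) : Matrix (Fin d) (Fin d) ℝ) *ᵥ
                    ((A ω : Matrix (Fin d) (Fin d) ℝ) *ᵥ x))))
              atTop (𝓝 l)) ∧
        -- consequently `A(ω) V_i(ω) = V_i(θω)`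
        ∃ hp : p (θ ω) = p ω,
          ∀ i : Fin (p ω),
            Submodule.map (Matrix.toLin' (A ω : Matrix (Fin d) (Fin d) ℝ))
              (⨆ j : Fin (p ω), ⨆ _ : i ≤ j,
                Module.End.eigenspace (Matrix.toLin' (Φ ω)) (Real.exp (lam ω j))) =
            ⨆ j : Fin (p (θ ω)), ⨆ _ : Fin.cast hp.symm i ≤ j,
              Module.End.eigenspace (Matrix.toLin' (Φ (θ ω))) (Real.exp (lam (θ ω) j)) := by
  have hae := ae_met hd ℙ θ hθpres A hA φ hφ0 hφ1 hφc hint₁ hint₂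
  have hch : ∀ ω, ∃ Φ E, (∃ Φ E, Met (fun n : ℕ => (φ (n : ℤ) ω : Matrix (Fin d) (Fin d) ℝ)) Φ E) →
      Met (fun n : ℕ => (φ (n : ℤ) ω : Matrix (Fin d) (Fin d) ℝ)) Φ E := by
    intro ω
    by_cases h : ∃ Φ E, Met (fun n : ℕ => (φ (n : ℤ) ω : Matrix (Fin d) (Fin d) ℝ)) Φ E
    · obtain ⟨Φ, E, hm⟩ := h
      exact ⟨Φ, E, fun _ => hm⟩
    · exact ⟨0, ∅, fun h' => absurd h' h⟩
  choose Φ E hM using hch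
  obtain ⟨S', hS'sub, hS'm, hS'0⟩ := exists_measurable_superset_of_null (ae_iff.1 hae)
  have hSP : ∀ ω, ω ∉ S' → Met (fun n : ℕ => (φ (n : ℤ) ω : Matrix (Fin d) (Fin d) ℝ)) (Φ ω) (E ω) := by
    intro ω hω
    apply hM
    by_contra h
    exact hω (hS'sub h)
  let e : Ω ≃ᵐ Ω := ⟨θ, hθmeas, hθinv⟩
  have he : MeasurePreserving e ℙ ℙ := hθpres
  have hes : MeasurePreserving (θ.symm : Ω → Ω) ℙ ℙ := he.symm e
  have hpow : ∀ n : ℤ, MeasurePreserving ((θ ^ n : Equiv.Perm Ω) : Ω → Ω) ℙ ℙ := by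
    intro n
    obtain ⟨k, rfl | rfl⟩ := n.eq_nat_or_neg
    · rw [zpow_natCast, ← Equiv.Perm.iterate_eq_pow]
      exact hθpres.iterate k
    · rw [_root_.zpow_neg, zpow_natCast, ← inv_pow, ← Equiv.Perm.iterate_eq_pow]
      exact hes.iterate k
  let N : Set Ω := ⋃ n : ℤ, ((θ ^ n : Equiv.Perm Ω) : Ω → Ω) ⁻¹' S'
  have hNm : MeasurableSet N := MeasurableSet.iUnion fun n => (hpow n).measurable hS'm
  have hN0 : ℙ N = 0 := measure_iUnion_null fun n => by
    rw [(hpow n).measure_preimage hS'm.nullMeasurableSet, hS'0]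
  have hmemN : ∀ ω, ω ∈ N ↔ ∃ n : ℤ, (θ ^ n) ω ∈ S' := fun ω => Set.mem_iUnion
  have hNinv : ∀ ω, θ ω ∈ N ↔ ω ∈ N := by
    intro ω
    rw [hmemN, hmemN]
    constructor
    · rintro ⟨n, hn⟩
      exact ⟨n + 1, by rw [_root_.zpow_add, zpow_one]; exact hn⟩
    · rintro ⟨n, hn⟩
      refine ⟨n - 1, ?_⟩
      have : (θ ^ (n - 1)) (θ ω) = (θ ^ n) ω := by
        rw [← Equiv.Perm.mul_apply, ← _root_.zpow_add_one, sub_add_cancel]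
      rw [this]; exact hn
  have hNP : ∀ ω, ω ∉ N → Met (fun n : ℕ => (φ (n : ℤ) ω : Matrix (Fin d) (Fin d) ℝ)) (Φ ω) (E ω) := by
    intro ω hω
    apply hSP
    intro h
    exact hω ((hmemN ω).2 ⟨0, by simpa using h⟩)
  -- the shift
  have hshift : ∀ ω x l, Tendsto (fun n : ℕ => (1 / (n : ℝ)) *
      Real.log (eNorm ((φ (n : ℤ) (θ ω) : Matrix (Fin d) (Fin d) ℝ) *ᵥ
        ((A ω : Matrix (Fin d) (Fin d) ℝ) *ᵥ x)))) atTop (𝓝 l) ↔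
      Tendsto (fun n : ℕ => (1 / (n : ℝ)) *
        Real.log (eNorm ((φ (n : ℤ) ω : Matrix (Fin d) (Fin d) ℝ) *ᵥ x))) atTop (𝓝 l) := by
    intro ω x l
    rw [← tendsto_shift (fun n : ℕ =>
      Real.log (eNorm ((φ (n : ℤ) ω : Matrix (Fin d) (Fin d) ℝ) *ᵥ x)))]
    have : ∀ n : ℕ, φ ((n + 1 : ℕ) : ℤ) ω = φ (n:ℤ) (θ ω) * A ω := by
      intro n
      rw [Nat.cast_add, Nat.cast_one, hφc, hφ1, zpow_one]
    simp only [this, Units.val_mul, mulVec_mulVec]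
  have hAinv : ∀ ω (y : Fin d → ℝ), (A ω : Matrix (Fin d) (Fin d) ℝ) *ᵥ
      ((((A ω)⁻¹ : GL (Fin d) ℝ) : Matrix (Fin d) (Fin d) ℝ) *ᵥ y) = y := by
    intro ω y
    rw [mulVec_mulVec, ← Units.val_mul, mul_inv_cancel, Units.val_one, one_mulVec]
  have hA0 : ∀ ω (x : Fin d → ℝ), (A ω : Matrix (Fin d) (Fin d) ℝ) *ᵥ x = 0 ↔ x = 0 := by
    intro ω x
    constructor
    · intro h
      have := congrArg (fun v => (((A ω)⁻¹ : GL (Fin d) ℝ) : Matrix (Fin d) (Fin d) ℝ) *ᵥ v) h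
      simp only [mulVec_zero] at this
      rwa [mulVec_mulVec, ← Units.val_mul, inv_mul_cancel, Units.val_one, one_mulVec] at this
    · rintro rfl; exact mulVec_zero _
  have hmemE : ∀ ω, ω ∉ N → ∀ l, l ∈ E ω ↔ ∃ x, x ≠ 0 ∧ Tendsto (fun n : ℕ => (1 / (n : ℝ)) *
        Real.log (eNorm ((φ (n : ℤ) ω : Matrix (Fin d) (Fin d) ℝ) *ᵥ x))) atTop (𝓝 l) := by
    intro ω hω l
    refine ⟨(hNP ω hω).att l, ?_⟩
    rintro ⟨x, hx, ht⟩
    obtain ⟨l', hl', ht'⟩ := (hNP ω hω).ly x hx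
    rw [tendsto_nhds_unique ht ht']; exact hl'
  refine ⟨Nᶜ, Φ, fun ω => (E ω).card, fun ω => lamE (E ω), hNm.compl, ?_, ?_, ?_⟩
  · rw [prob_compl_eq_one_iff hNm]; exact hN0
  · ext ω
    simp only [Set.mem_preimage, Set.mem_compl_iff, hNinv]
  intro ω hω
  rw [Set.mem_compl_iff] at hω
  have hω' : θ ω ∉ N := fun h => hω ((hNinv ω).1 h)
  have M1 := hNP ω hω
  have M2 := hNP (θ ω) hω'
  have hE : E (θ ω) = E ω := by
    ext l
    rw [hmemE _ hω', hmemE _ hω]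
    constructor
    · rintro ⟨y, hy, ht⟩
      refine ⟨(((A ω)⁻¹ : GL (Fin d) ℝ) : Matrix (Fin d) (Fin d) ℝ) *ᵥ y, ?_, ?_⟩
      · intro h0
        apply hy
        rw [← hAinv ω y, h0, mulVec_zero]
      · rw [← hshift]
        simp only [hAinv]
        exact ht
    · rintro ⟨x, hx, ht⟩
      exact ⟨_, fun h => hx ((hA0 ω x).1 h), (hshift ω x l).2 ht⟩
  refine ⟨⟨M1.symm, M1.pos, M1.lim⟩, lamE_anti _, ?_, ?_, ?_⟩
  · intro μ
    rw [M1.eig]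
    constructor
    · rintro ⟨c, hc, rfl⟩
      obtain ⟨i, rfl⟩ := lamE_surj _ hc
      exact ⟨i, rfl⟩
    · rintro ⟨i, rfl⟩
      exact ⟨_, lamE_mem _ i, rfl⟩
  · intro x hx
    obtain ⟨l, _, ht⟩ := M1.ly x hx
    exact ⟨l, ht, (hshift ω x l).2 ht⟩
  · have hc : (E (θ ω)).card = (E ω).card := by rw [hE]
    refine ⟨hc, fun i => ?_⟩
    have s1 := lamE_sup (E ω) (fun a => Module.End.eigenspace (Matrix.toLin' (Φ ω)) (Real.exp a)) i
    have s2 := lamE_sup (E (θ ω)) (fun a => Module.End.eigenspace (Matrix.toLin' (Φ (θ ω))) (Real.exp a))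
      (Fin.cast hc.symm i)
    rw [s1, s2, lamE_cast hE hc.symm i]
    ext y
    rw [M2.fil, Submodule.mem_map]
    constructor
    · rintro ⟨x, hx, rfl⟩
      rw [toLin'_apply]
      rcases (M1.fil _ x).1 hx with rfl | ⟨l, hl, ht⟩
      · left; exact mulVec_zero _
      · right; exact ⟨l, hl, (hshift ω x l).2 ht⟩
    · intro hy
      refine ⟨(((A ω)⁻¹ : GL (Fin d) ℝ) : Matrix (Fin d) (Fin d) ℝ) *ᵥ y, ?_, ?_⟩
      · rw [M1.fil]
        rcases hy with rfl | ⟨l, hl, ht⟩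
        · left; exact mulVec_zero _
        · right
          refine ⟨l, hl, ?_⟩
          rw [← hshift]
          simp only [hAinv]
          exact ht
      · rw [toLin'_apply]; exact hAinv ω y
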